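/- If H is a subgraph of a smallest counterexample and H contains at least two distinct cycles, then H has at least 9 vertices. In particular, any two 5-cycles in a smallest counterexample are edge-disjoint. -/

import Mathlib

open SimpleGraph

/-- The degree of a vertex, as the cardinality of its neighbor set. -/
noncomputable def deg {V : Type} (G : SimpleGraph V) (v : V) : ℕ :=
  (G.neighborSet v).ncard

/-- The potential of a finite graph: `5 n(G) - 4 e(G)`. -/
noncomputable def pot {V : Type} [Fintype V] (G : SimpleGraph V) : ℤ :=
  5 * (Fintype.card V : ℤ) - 4 * (G.edgeSet.ncard : ℤ)

/-- A graph is 5/2-critical if it has no homomorphism to the 5-cycle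
but every proper subgraph has one. -/
def Critical52 {V : Type} (G : SimpleGraph V) : Prop :=
  IsEmpty (G →g cycleGraph 5) ∧
  ∀ H : G.Subgraph, H ≠ ⊤ → Nonempty (H.coe →g cycleGraph 5)

/-- The exceptional graph `E₁`: a 9-cycle `0 1 2 3 4 5 6 7 8` together
with a vertex `9` adjacent to `0`, `3` and `6`. -/
def E1 : SimpleGraph (Fin 10) := SimpleGraph.fromEdgeSet
  {s(0,1), s(1,2), s(2,3), s(3,4), s(4,5), s(5,6), s(6,7), s(7,8), s(8,0),
   s(9,0), s(9,3), s(9,6)}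

/-- The exceptional graph `E₂`: two 5-cycles `0 1 2 3 4` and `0 1 5 6 7`
sharing exactly the edge `01`, together with a path `3 8 9 6`. -/
def E2 : SimpleGraph (Fin 10) := SimpleGraph.fromEdgeSet
  {s(0,1), s(1,2), s(2,3), s(3,4), s(4,0),
   s(1,5), s(5,6), s(6,7), s(7,0),
   s(3,8), s(8,9), s(9,6)}

/-- A smallest counterexample: a 5/2-critical graph, not isomorphic to `C₃`, `E₁`, `E₂`,
with potential at least 2, such that every smaller 5/2-critical graph not isomorphic
to `C₃`, `E₁`, `E₂` has potential at most 1. -/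
def SmallestCex {V : Type} [Fintype V] (G : SimpleGraph V) : Prop :=
  Critical52 G ∧ IsEmpty (G ≃g cycleGraph 3) ∧ IsEmpty (G ≃g E1) ∧ IsEmpty (G ≃g E2) ∧
  2 ≤ pot G ∧
  ∀ (m : ℕ) (H : SimpleGraph (Fin m)), Critical52 H →
    IsEmpty (H ≃g cycleGraph 3) → IsEmpty (H ≃g E1) → IsEmpty (H ≃g E2) →
    m < Fintype.card V → pot H ≤ 1

/-- A string: a path of positive length whose endvertices have degree at least 3
and whose internal vertices have degree 2. A `k`-string is a string of length `k+1`. -/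
def IsString {V : Type} (G : SimpleGraph V) {u v : V} (p : G.Walk u v) : Prop :=
  p.IsPath ∧ 0 < p.length ∧ 3 ≤ deg G u ∧ 3 ≤ deg G v ∧
  ∀ w ∈ p.support, w ≠ u → w ≠ v → deg G w = 2

/-- `v` lies on a 5-cycle of `G`. -/
def InFiveCycle {V : Type} (G : SimpleGraph V) (v : V) : Prop :=
  ∃ (w : V) (c : G.Walk w w), c.IsCycle ∧ c.length = 5 ∧ v ∈ c.support

/-- `v` is a `(k₁,k₂,k₃)`-vertex: it has degree 3 and is the end of a `k₁`-string,
a `k₂`-string and a `k₃`-string leaving `v` through its three distinct edges. -/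
def IsVertex3 {V : Type} (G : SimpleGraph V) (v : V) (k1 k2 k3 : ℕ) : Prop :=
  deg G v = 3 ∧ ∃ (u1 u2 u3 : V) (p1 : G.Walk v u1) (p2 : G.Walk v u2) (p3 : G.Walk v u3),
    IsString G p1 ∧ IsString G p2 ∧ IsString G p3 ∧
    p1.getVert 1 ≠ p2.getVert 1 ∧ p1.getVert 1 ≠ p3.getVert 1 ∧ p2.getVert 1 ≠ p3.getVert 1 ∧
    p1.length = k1 + 1 ∧ p2.length = k2 + 1 ∧ p3.length = k3 + 1

/-- `v` is a `(k₁,k₂,k₃,k₄)`-vertex: it has degree 4 and is the end of strings of the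
corresponding lengths leaving `v` through its four distinct edges. -/
def IsVertex4 {V : Type} (G : SimpleGraph V) (v : V) (k1 k2 k3 k4 : ℕ) : Prop :=
  deg G v = 4 ∧ ∃ (u1 u2 u3 u4 : V) (p1 : G.Walk v u1) (p2 : G.Walk v u2)
    (p3 : G.Walk v u3) (p4 : G.Walk v u4),
    IsString G p1 ∧ IsString G p2 ∧ IsString G p3 ∧ IsString G p4 ∧
    p1.getVert 1 ≠ p2.getVert 1 ∧ p1.getVert 1 ≠ p3.getVert 1 ∧ p1.getVert 1 ≠ p4.getVert 1 ∧
    p2.getVert 1 ≠ p3.getVert 1 ∧ p2.getVert 1 ≠ p4.getVert 1 ∧ p3.getVert 1 ≠ p4.getVert 1 ∧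
    p1.length = k1 + 1 ∧ p2.length = k2 + 1 ∧ p3.length = k3 + 1 ∧ p4.length = k4 + 1

/-- `H` contains at least two distinct cycles, where cycles are counted as subgraphs,
i.e. two cycles are distinct if their edge sets differ. -/
def TwoDistinctCycles {V : Type} (H : SimpleGraph V) : Prop :=
  ∃ (v1 v2 : V) (c1 : H.Walk v1 v1) (c2 : H.Walk v2 v2),
    c1.IsCycle ∧ c2.IsCycle ∧ {e | e ∈ c1.edges} ≠ {e | e ∈ c2.edges}

/-- The degree of a 5-cycle (cell) `c` in `G`: the number of strings not contained in `c`
that intersect `c`, strings being counted by their edge sets. -/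
noncomputable def cellDegree {V : Type} (G : SimpleGraph V) {w : V} (c : G.Walk w w) : ℕ :=
  {S : Set (Sym2 V) | ∃ (u v : V) (p : G.Walk u v), IsString G p ∧ S = {e | e ∈ p.edges} ∧
    ¬ S ⊆ {e | e ∈ c.edges} ∧ ∃ x ∈ p.support, x ∈ c.support}.ncard

section TwoCyclesAux

/-- `c` is a valid 5-cycle coloring of the graph `G` on the vertex set `S`. -/
def GoodOn {V : Type} (G : SimpleGraph V) (S : Finset V) (c : V → Fin 5) : Prop :=
  ∀ v ∈ S, ∀ w ∈ S, G.Adj v w → (cycleGraph 5).Adj (c v) (c w)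

open Classical in
/-- Edges of `G` inside `S`. -/
noncomputable def eIn {V : Type} [Fintype V] (G : SimpleGraph V) (S : Finset V) :
    Finset (Sym2 V) :=
  Finset.univ.filter (fun e => e ∈ G.edgeSet ∧ ∀ v ∈ e, v ∈ S)

/-- Potential of a vertex subset. -/
noncomputable def pS {V : Type} [Fintype V] (G : SimpleGraph V) (S : Finset V) : ℤ :=
  5 * (S.card : ℤ) - 4 * ((eIn G S).card : ℤ)

lemma mem_eIn {V : Type} [Fintype V] (G : SimpleGraph V) (S : Finset V) (e : Sym2 V) :
    e ∈ eIn G S ↔ e ∈ G.edgeSet ∧ ∀ v ∈ e, v ∈ S := by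
  classical
  simp [eIn]

lemma mk_mem_eIn {V : Type} [Fintype V] (G : SimpleGraph V) (S : Finset V) (a b : V) :
    s(a, b) ∈ eIn G S ↔ G.Adj a b ∧ a ∈ S ∧ b ∈ S := by
  rw [mem_eIn]; simp

lemma pot_eq {V : Type} [Fintype V] (G : SimpleGraph V) : pot G = pS G Finset.univ := by
  classical
  unfold pot pS
  rw [Finset.card_univ]
  congr 3
  rw [← Set.ncard_coe_finset]
  congr 1
  ext e
  simp [mem_eIn]

lemma eIn_mono {V : Type} [Fintype V] (G : SimpleGraph V) {S T : Finset V} (h : S ⊆ T) :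
    eIn G S ⊆ eIn G T := by
  intro e
  rw [mem_eIn, mem_eIn]
  exact fun ⟨a, b⟩ => ⟨a, fun v hv => h (b v hv)⟩

open Classical in
lemma eIn_insert {V : Type} [Fintype V] (G : SimpleGraph V) (S : Finset V) (w : V) (hw : w ∉ S) :
    (eIn G (insert w S)).card = (eIn G S).card + (S.filter (fun x => G.Adj w x)).card := by
  have h1 : eIn G (insert w S) = eIn G S ∪ (S.filter (fun x => G.Adj w x)).image (fun x => s(w, x)) := by
    ext e
    induction e with | _ a b =>
    simp only [Finset.mem_union, mk_mem_eIn, Finset.mem_insert, Finset.mem_image, Finset.mem_filter,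
      Sym2.eq_iff]
    constructor
    · rintro ⟨h, rfl | ha, rfl | hb⟩
      · exact absurd h (G.loopless.irrefl _)
      · exact Or.inr ⟨b, ⟨hb, h⟩, Or.inl ⟨rfl, rfl⟩⟩
      · exact Or.inr ⟨a, ⟨ha, h.symm⟩, Or.inr ⟨rfl, rfl⟩⟩
      · exact Or.inl ⟨h, ha, hb⟩
    · rintro (⟨h, ha, hb⟩ | ⟨x, ⟨hx, hwx⟩, ⟨rfl, rfl⟩ | ⟨rfl, rfl⟩⟩)
      · exact ⟨h, Or.inr ha, Or.inr hb⟩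
      · exact ⟨hwx, Or.inl rfl, Or.inr hx⟩
      · exact ⟨hwx.symm, Or.inr hx, Or.inl rfl⟩
  rw [h1, Finset.card_union_of_disjoint, Finset.card_image_of_injective]
  · intro x y h
    rcases Sym2.eq_iff.1 h with h | h
    · exact h.2
    · exact h.2.trans h.1
  · rw [Finset.disjoint_left]
    intro e he
    simp only [Finset.mem_image, not_exists, not_and]
    rintro x _ rfl
    rw [mk_mem_eIn] at he
    exact hw he.2.1

lemma eIn_submod {V : Type} [Fintype V] [DecidableEq V] (G : SimpleGraph V) (S T : Finset V) :
    (eIn G S).card + (eIn G T).card ≤ (eIn G (S ∪ T)).card + (eIn G (S ∩ T)).card := by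
  classical
  have h1 := Finset.card_union_add_card_inter (eIn G S) (eIn G T)
  have h2 : (eIn G S ∪ eIn G T).card ≤ (eIn G (S ∪ T)).card :=
    Finset.card_le_card (Finset.union_subset (eIn_mono G Finset.subset_union_left)
      (eIn_mono G Finset.subset_union_right))
  have h3 : (eIn G S ∩ eIn G T).card ≤ (eIn G (S ∩ T)).card := by
    apply Finset.card_le_card
    intro e
    rw [Finset.mem_inter, mem_eIn, mem_eIn, mem_eIn]
    exact fun ⟨⟨a, b⟩, ⟨_, d⟩⟩ => ⟨a, fun v hv => Finset.mem_inter.2 ⟨b v hv, d v hv⟩⟩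
  omega

lemma sub_col {V : Type} {G : SimpleGraph V} (H : G.Subgraph) :
    Nonempty (H.coe →g cycleGraph 5) ↔
      ∃ c : V → Fin 5, ∀ v w, H.Adj v w → (cycleGraph 5).Adj (c v) (c w) := by
  classical
  constructor
  · rintro ⟨f⟩
    refine ⟨fun v => if h : v ∈ H.verts then f ⟨v, h⟩ else 0, fun v w h => ?_⟩
    simp only [dif_pos h.fst_mem, dif_pos h.snd_mem]
    exact f.map_rel (by simpa using h)
  · rintro ⟨c, hc⟩
    exact ⟨⟨fun v => c v, fun {a b} h => hc _ _ h⟩⟩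

lemma crit_iff {V : Type} {G : SimpleGraph V} : Critical52 G ↔
    (¬ ∃ c : V → Fin 5, ∀ v w, G.Adj v w → (cycleGraph 5).Adj (c v) (c w)) ∧
    ∀ H : G.Subgraph, H ≠ ⊤ →
      ∃ c : V → Fin 5, ∀ v w, H.Adj v w → (cycleGraph 5).Adj (c v) (c w) := by
  unfold Critical52
  simp only [sub_col]
  refine and_congr_left fun _ => ?_
  rw [← not_nonempty_iff, not_iff_not]
  exact ⟨fun ⟨f⟩ => ⟨f, fun v w h => f.map_rel h⟩, fun ⟨c, hc⟩ => ⟨⟨c, fun {a b} h => hc a b h⟩⟩⟩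

lemma crit_iso {V W : Type} {G : SimpleGraph V} {H : SimpleGraph W} (φ : G ≃g H)
    (h : Critical52 G) : Critical52 H := by
  rw [crit_iff] at h ⊢
  obtain ⟨h1, h2⟩ := h
  refine ⟨fun ⟨c, hc⟩ => h1 ⟨fun v => c (φ v), fun v w hvw => hc _ _ (φ.map_adj_iff.2 hvw)⟩, ?_⟩
  intro K hK
  obtain ⟨c, hc⟩ := h2
    { verts := φ ⁻¹' K.verts
      Adj := fun x y => K.Adj (φ x) (φ y)
      adj_sub := fun h => φ.map_adj_iff.1 (K.adj_sub h)
      edge_vert := fun h => K.edge_vert h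
      symm := ⟨fun x y h => K.symm.symm _ _ h⟩ } (by
      intro heq
      apply hK
      have hv := congrArg Subgraph.verts heq
      have ha := congrArg Subgraph.Adj heq
      simp only [Subgraph.verts_top] at hv
      ext x y
      · have : φ.symm x ∈ φ ⁻¹' K.verts := by rw [hv]; trivial
        simpa using this
      · have := congrFun (congrFun ha (φ.symm x)) (φ.symm y)
        simp only [RelIso.apply_symm_apply, Subgraph.top_adj] at this
        rw [this]
        simp only [Subgraph.top_adj]
        rw [φ.symm.map_adj_iff])
  refine ⟨fun x => c (φ.symm x), fun x y hxy => hc _ _ ?_⟩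
  simpa using hxy

/-- The minimality hypothesis for arbitrary finite types. -/
lemma small_pot {V : Type} [Fintype V] {G : SimpleGraph V} (h : SmallestCex G)
    {W : Type} [Fintype W] (H : SimpleGraph W) (hc : Critical52 H)
    (hlt : Fintype.card W < Fintype.card V) :
    pot H ≤ 1 ∨ Nonempty (H ≃g cycleGraph 3) ∨ Nonempty (H ≃g E1) ∨ Nonempty (H ≃g E2) := by
  classical
  by_contra hcon
  push Not at hcon
  obtain ⟨hp, h3, h1, h2⟩ := hcon
  obtain ⟨_, _, _, _, _, hs⟩ := h
  let φ := Fintype.equivFin W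
  let K : SimpleGraph (Fin (Fintype.card W)) := H.map φ.toEmbedding
  let ψ : H ≃g K := SimpleGraph.Iso.map φ H
  have := hs _ K (crit_iso ψ hc)
    ⟨fun i => h3.elim' (ψ.trans i)⟩ ⟨fun i => h1.elim' (ψ.trans i)⟩ ⟨fun i => h2.elim' (ψ.trans i)⟩ hlt
  have he : pot K = pot H := by
    unfold pot
    rw [Fintype.card_fin]
    congr 3
    rw [← Nat.card_coe_set_eq, ← Nat.card_coe_set_eq]
    exact Nat.card_congr (ψ.mapEdgeSet).symm
  omega

lemma pot_iso {V W : Type} [Fintype V] [Fintype W] {G : SimpleGraph V} {H : SimpleGraph W}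
    (φ : G ≃g H) : pot G = pot H := by
  unfold pot
  rw [Fintype.card_congr φ.toEquiv, ← Nat.card_coe_set_eq, ← Nat.card_coe_set_eq,
    Nat.card_congr φ.mapEdgeSet]

/-- Boolean version of the adjacency of `E1`. -/
def l1 : List (ℕ × ℕ) := [(0,1), (1,2), (2,3), (3,4), (4,5), (5,6), (6,7), (7,8), (8,0),
   (9,0), (9,3), (9,6)]

/-- Boolean version of the adjacency of `E2`. -/
def l2 : List (ℕ × ℕ) := [(0,1), (1,2), (2,3), (3,4), (4,0), (1,5), (5,6), (6,7), (7,0),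
   (3,8), (8,9), (9,6)]

lemma E1_adj (x y : Fin 10) :
    E1.Adj x y ↔ ((x.1, y.1) ∈ l1 ∨ (y.1, x.1) ∈ l1) := by
  simp only [E1, SimpleGraph.fromEdgeSet_adj, Set.mem_insert_iff, Set.mem_singleton_iff]
  revert x y
  decide +kernel

lemma E2_adj (x y : Fin 10) :
    E2.Adj x y ↔ ((x.1, y.1) ∈ l2 ∨ (y.1, x.1) ∈ l2) := by
  simp only [E2, SimpleGraph.fromEdgeSet_adj, Set.mem_insert_iff, Set.mem_singleton_iff]
  revert x y
  decide +kernel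

lemma pot_E1 : pot E1 ≤ 2 := by
  have : 12 ≤ E1.edgeSet.ncard := by
    have h : ((({s(0,1), s(1,2), s(2,3), s(3,4), s(4,5), s(5,6), s(6,7), s(7,8), s(8,0),
      s(9,0), s(9,3), s(9,6)} : Finset (Sym2 (Fin 10))) : Set (Sym2 (Fin 10)))) ⊆ E1.edgeSet := by
      intro e he
      rw [E1, SimpleGraph.edgeSet_fromEdgeSet]
      refine ⟨by simpa using he, ?_⟩
      intro hd
      revert e
      decide +kernel
    have := Set.ncard_le_ncard h
    rw [Set.ncard_coe_finset] at this
    exact le_trans (by decide +kernel) this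
  unfold pot
  simp only [Fintype.card_fin]
  omega

lemma pot_E2 : pot E2 ≤ 2 := by
  have : 12 ≤ E2.edgeSet.ncard := by
    have h : ((({s(0,1), s(1,2), s(2,3), s(3,4), s(4,0), s(1,5), s(5,6), s(6,7), s(7,0),
   s(3,8), s(8,9), s(9,6)} : Finset (Sym2 (Fin 10))) : Set (Sym2 (Fin 10)))) ⊆ E2.edgeSet := by
      intro e he
      rw [E2, SimpleGraph.edgeSet_fromEdgeSet]
      refine ⟨by simpa using he, ?_⟩
      intro hd
      revert e
      decide +kernel
    have := Set.ncard_le_ncard h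
    rw [Set.ncard_coe_finset] at this
    exact le_trans (by decide +kernel) this
  unfold pot
  simp only [Fintype.card_fin]
  omega

lemma c5_bound : ∀ A : Finset (Fin 5), A.Nonempty →
    5 + 4 * ((Finset.univ : Finset (Sym2 (Fin 5))).filter
      (fun e => e ∈ (cycleGraph 5).edgeSet ∧ e ∈ A.sym2)).card ≤ 5 * A.card ∧
    (2 ≤ A.card → A.card ≤ 3 → 6 + 4 * ((Finset.univ : Finset (Sym2 (Fin 5))).filter
      (fun e => e ∈ (cycleGraph 5).edgeSet ∧ e ∈ A.sym2)).card ≤ 5 * A.card) := by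
  decide +kernel
lemma eIn_c5 (A : Finset (Fin 5)) : eIn (cycleGraph 5) A = (Finset.univ : Finset (Sym2 (Fin 5))).filter
      (fun e => e ∈ (cycleGraph 5).edgeSet ∧ e ∈ A.sym2) := by
  ext e
  simp [mem_eIn, Finset.mem_sym2_iff]

lemma inj_edges {V : Type} [Fintype V] (X : Finset V) (E : Finset (Sym2 V)) (f : V → Fin 5)
    [DecidableEq V]
    (hf : Set.InjOn f X) (hE : ∀ a b, s(a, b) ∈ E → a ∈ X ∧ b ∈ X ∧ (cycleGraph 5).Adj (f a) (f b)) :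
    E.card ≤ (eIn (cycleGraph 5) (X.image f)).card := by
  classical
  apply Finset.card_le_card_of_injOn (Sym2.map f)
  · intro e he
    induction e with | _ a b =>
    obtain ⟨h1, h2, h3⟩ := hE a b he
    simp only [Sym2.map_mk, Finset.mem_coe]
    rw [mk_mem_eIn]
    exact ⟨h3, Finset.mem_image_of_mem f h1, Finset.mem_image_of_mem f h2⟩
  · intro e he e' he' h
    induction e with | _ a b =>
    induction e' with | _ c d =>
    obtain ⟨h1, h2, h3⟩ := hE a b he
    obtain ⟨h1', h2', h3'⟩ := hE c d he'
    simp only [Sym2.map_mk, Sym2.eq_iff] at h ⊢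
    rcases h with ⟨p, q⟩ | ⟨p, q⟩
    · exact Or.inl ⟨hf h1 h1' p, hf h2 h2' q⟩
    · exact Or.inr ⟨hf h1 h2' p, hf h2 h1' q⟩

lemma crit_goodOn {V : Type} [Fintype V] {G : SimpleGraph V} (h : Critical52 G) (S : Finset V)
    (hS : S ≠ Finset.univ) : ∃ c, GoodOn G S c := by
  rw [crit_iff] at h
  obtain ⟨c, hc⟩ := h.2 ((⊤ : G.Subgraph).induce (S : Set V)) (by
    intro heq
    have := congrArg Subgraph.verts heq
    simp only [Subgraph.induce_verts, Subgraph.verts_top] at this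
    exact hS (by simpa using this))
  exact ⟨c, fun v hv w hw hvw => hc v w (by simp [hv, hw, hvw])⟩

lemma pot_coe {V : Type} [Fintype V] {G : SimpleGraph V} (W : G.Subgraph) [Fintype W.verts] :
    pot W.coe = 5 * (Fintype.card W.verts : ℤ) - 4 * ((eIn W.spanningCoe Finset.univ).card : ℤ) := by
  classical
  unfold pot
  congr 3
  rw [← Set.ncard_image_of_injective W.coe.edgeSet (Sym2.map.injective Subtype.val_injective),
    Subgraph.image_coe_edgeSet_coe, ← Set.ncard_coe_finset]
  congr 1
  ext e
  simp [mem_eIn]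

/-- A non-colorable subgraph of a finite graph contains a critical one. -/
lemma exists_crit {V : Type} [Fintype V] {G : SimpleGraph V} (R : G.Subgraph)
    (hR : ¬ ∃ c : V → Fin 5, ∀ v w, R.Adj v w → (cycleGraph 5).Adj (c v) (c w)) :
    ∃ W ≤ R, Critical52 W.coe := by
  classical
  obtain ⟨W, hWR, hW⟩ := Set.Finite.exists_le_minimal (s := {W : G.Subgraph |
    ¬ ∃ c : V → Fin 5, ∀ v w, W.Adj v w → (cycleGraph 5).Adj (c v) (c w)}) (Set.toFinite _) hR
  refine ⟨W, hWR, ?_, ?_⟩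
  · rw [← not_nonempty_iff, sub_col]
    exact hW.1
  · intro H hH
    by_contra hcon
    have hle : Subgraph.coeSubgraph H ≤ W := Subgraph.coeSubgraph_le H
    have hge := hW.2 (y := Subgraph.coeSubgraph H) (by
      rintro ⟨c, hc⟩
      apply hcon
      refine ⟨⟨fun v => c v.1.1, fun {a b} hab => hc _ _ ?_⟩⟩
      rw [Subgraph.coeSubgraph_adj]
      exact ⟨a.1.2, b.1.2, hab⟩) hle
    apply hH
    ext x y
    · simp only [Subgraph.verts_top, Set.mem_univ, iff_true]
      have := hge.1 x.2
      rw [Subgraph.verts_coeSubgraph] at this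
      obtain ⟨z, hz, hzx⟩ := this
      rwa [← Subtype.ext hzx]
    · constructor
      · exact fun h => H.adj_sub h
      · intro h
        have := hge.2 h
        rw [Subgraph.coeSubgraph_adj] at this
        obtain ⟨_, _, h⟩ := this
        exact h

lemma pot_C3 : pot (cycleGraph 3) ≤ 3 := by
  have : 3 ≤ (cycleGraph 3).edgeSet.ncard := by
    have h : ((({s(0,1), s(1,2), s(2,0)} : Finset (Sym2 (Fin 3))) : Set (Sym2 (Fin 3)))) ⊆
        (cycleGraph 3).edgeSet := by
      intro e he
      simp only [Finset.mem_coe] at he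
      revert e
      decide +kernel
    have := Set.ncard_le_ncard h
    rw [Set.ncard_coe_finset] at this
    exact le_trans (by decide +kernel) this
  unfold pot
  simp only [Fintype.card_fin]
  omega

/-- The core of the potential method. -/
lemma core {V : Type} [Fintype V] {G : SimpleGraph V} (h : SmallestCex G) (S : Finset V)
    (hne : S.Nonempty) (hS : S ≠ Finset.univ) (hp : pS G S ≤ 4) :
    (∃ S', S ⊆ S' ∧ pS G S' ≤ pS G S - 3) ∨
    ∃ a b u v, a ∉ S ∧ b ∉ S ∧ u ∈ S ∧ v ∈ S ∧ G.Adj a b ∧ G.Adj a u ∧ G.Adj b v := by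
  classical
  have hcrit := h.1
  obtain ⟨f, hf⟩ := crit_goodOn hcrit S hS
  -- `f` is not injective on `S`
  have hninj : ¬ Set.InjOn f S := by
    intro hinj
    have h1 := inj_edges S (eIn G S) f hinj (fun a b hab => by
      rw [mk_mem_eIn] at hab
      exact ⟨hab.2.1, hab.2.2, hf a hab.2.1 b hab.2.2 hab.1⟩)
    have h2 := (c5_bound (S.image f) (hne.image f)).1
    rw [← eIn_c5, Finset.card_image_of_injOn hinj] at h2
    unfold pS at hp
    omega
  -- the identification map
  obtain ⟨π, hπ1, hπ2, hπ3⟩ : ∃ π : V → V, (∀ x, x ∉ S → π x = x) ∧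
      (∀ x ∈ S, π x ∈ S ∧ f (π x) = f x) ∧ (∀ x ∈ S, ∀ y ∈ S, f x = f y → π x = π y) := by
    obtain ⟨s0, hs0⟩ := hne
    let g : Fin 5 → V := fun c => if hc : ∃ s ∈ S, f s = c then hc.choose else s0
    have hg : ∀ x ∈ S, g (f x) ∈ S ∧ f (g (f x)) = f x := by
      intro x hx
      have hc : ∃ s ∈ S, f s = f x := ⟨x, hx, rfl⟩
      have : g (f x) = hc.choose := dif_pos hc
      rw [this]
      exact hc.choose_spec
    refine ⟨fun x => if x ∈ S then g (f x) else x, fun x hx => if_neg hx, fun x hx => ?_,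
      fun x hx y hy hxy => ?_⟩
    · simp only [if_pos hx]; exact hg x hx
    · simp only [if_pos hx, if_pos hy, hxy]
  have hπS : ∀ x, π x ∈ S ↔ x ∈ S := by
    intro x
    refine ⟨fun hx => ?_, fun hx => (hπ2 x hx).1⟩
    by_contra hn
    rw [hπ1 x hn] at hx
    exact hn hx
  have hπsurj : ¬ Function.Surjective π := by
    intro hs
    have hi := Finite.injective_iff_surjective.2 hs
    exact hninj fun x hx y hy hxy => hi (hπ3 x hx y hy hxy)
  -- the quotient graph
  let G' : SimpleGraph V :=
    { Adj := fun x y => ∃ v w, G.Adj v w ∧ π v = x ∧ π w = y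
      symm := ⟨fun x y ⟨v, w, hvw, hv, hw⟩ => ⟨w, v, hvw.symm, hw, hv⟩⟩
      loopless := ⟨by
        rintro x ⟨v, w, hvw, rfl, hw⟩
        by_cases hv : v ∈ S
        · have hwS : w ∈ S := by rw [← hπS, hw, hπS]; exact hv
          have h1 := hf v hv w hwS hvw
          rw [← (hπ2 v hv).2, ← (hπ2 w hwS).2, hw] at h1
          exact (cycleGraph 5).loopless.irrefl _ h1
        · have hwS : w ∉ S := by rw [← hπS, hw, hπS]; exact hv
          rw [hπ1 v hv, hπ1 w hwS] at hw
          rw [hw] at hvw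
          exact G.loopless.irrefl _ hvw⟩ }
  let R : G'.Subgraph :=
    { verts := Set.range π
      Adj := G'.Adj
      adj_sub := fun h => h
      edge_vert := by rintro x y ⟨v, w, hvw, rfl, rfl⟩; exact ⟨v, rfl⟩
      symm := G'.symm }
  obtain ⟨W, hWR, hWc⟩ := exists_crit R (by
    rintro ⟨c, hc⟩
    exact (crit_iff.1 hcrit).1 ⟨fun v => c (π v), fun v w hvw => hc _ _ ⟨v, w, hvw, rfl, rfl⟩⟩)
  have hcard : Fintype.card W.verts < Fintype.card V := by
    rw [← Set.toFinset_card, ← Finset.card_univ]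
    apply Finset.card_lt_card
    rw [Finset.ssubset_univ_iff]
    intro heq
    apply hπsurj
    intro x
    have : x ∈ W.verts.toFinset := by rw [heq]; exact Finset.mem_univ x
    exact hWR.1 (Set.mem_toFinset.1 this)
  have hsmall := small_pot h W.coe hWc hcard
  let X : Finset V := W.verts.toFinset ∩ S
  let Y : Finset V := W.verts.toFinset \ S
  have hXY : X.card + Y.card = Fintype.card W.verts := by
    rw [← Set.toFinset_card]
    exact Finset.card_inter_add_card_sdiff _ _
  have hinjX : Set.InjOn f X := by
    intro x hx y hy hxy
    simp only [X, Finset.coe_inter, Set.mem_inter_iff, Set.coe_toFinset, Finset.mem_coe] at hx hy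
    obtain ⟨x', rfl⟩ := hWR.1 hx.1
    obtain ⟨y', rfl⟩ := hWR.1 hy.1
    have hx' := (hπS _).1 hx.2
    have hy' := (hπS _).1 hy.2
    apply hπ3 _ hx' _ hy'
    rw [← (hπ2 x' hx').2, ← (hπ2 y' hy').2, hxy]
  -- lifting adjacency
  have hlift : ∀ x y, W.Adj x y → ∃ v w, G.Adj v w ∧ π v = x ∧ π w = y :=
    fun x y hxy => W.adj_sub hxy
  have hout : ∀ x, x ∉ S → ∀ v, π v = x → v = x := by
    intro x hx v hv
    have : v ∉ S := by rw [← hπS, hv]; exact hx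
    rw [← hv, hπ1 v this]
  have hXne : X.Nonempty := by
    by_contra hXe
    rw [Finset.not_nonempty_iff_eq_empty] at hXe
    obtain ⟨c, hc⟩ := crit_goodOn hcrit (Finset.univ \ S) (by
      intro heq
      obtain ⟨s, hs⟩ := hne
      have : s ∈ Finset.univ \ S := by rw [heq]; exact Finset.mem_univ s
      simp [hs] at this)
    have hWS : ∀ x ∈ W.verts, x ∉ S := by
      intro x hx hxS
      have : x ∈ X := by simp [X, hx, hxS]
      rw [hXe] at this
      simp at this
    apply (not_nonempty_iff.2 hWc.1)
    rw [sub_col]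
    refine ⟨c, fun x y hxy => ?_⟩
    obtain ⟨v, w, hvw, hv, hw⟩ := hlift x y hxy
    have hx := hWS x hxy.fst_mem
    have hy := hWS y hxy.snd_mem
    rw [hout x hx v hv, hout y hy w hw] at hvw
    exact hc x (by simp [hx]) y (by simp [hy]) hvw
  -- the edges of `W`
  let EX := (eIn W.spanningCoe Finset.univ).filter (fun e => ∀ v ∈ e, v ∈ S)
  let EY := (eIn W.spanningCoe Finset.univ).filter (fun e => ¬ ∀ v ∈ e, v ∈ S)
  have hE : EX.card + EY.card = (eIn W.spanningCoe Finset.univ).card :=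
    Finset.card_filter_add_card_filter_not _
  have hEX : EX.card ≤ (eIn (cycleGraph 5) (X.image f)).card := by
    apply inj_edges X EX f hinjX
    intro a b hab
    simp only [EX, Finset.mem_filter, mk_mem_eIn, Subgraph.spanningCoe_adj, Sym2.mem_iff,
      forall_eq_or_imp, forall_eq] at hab
    obtain ⟨⟨hab, -⟩, ha, hb⟩ := hab
    refine ⟨by simp [X, hab.fst_mem, ha], by simp [X, hab.snd_mem, hb], ?_⟩
    obtain ⟨v, w, hvw, rfl, rfl⟩ := hlift a b hab
    have hv := (hπS v).1 ha
    have hw := (hπS w).1 hb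
    rw [(hπ2 v hv).2, (hπ2 w hw).2]
    exact hf v hv w hw hvw
  let S' := S ∪ Y
  have hS'card : S'.card = S.card + Y.card :=
    Finset.card_union_of_disjoint (Finset.disjoint_sdiff)
  have hEY : (eIn G S).card + EY.card ≤ (eIn G S').card := by
    have h1 : EY ⊆ ((eIn G S') \ (eIn G S)).image (Sym2.map π) := by
      intro e he
      induction e with | _ a b =>
      simp only [EY, Finset.mem_filter, mk_mem_eIn, Subgraph.spanningCoe_adj, Sym2.mem_iff,
        forall_eq_or_imp, forall_eq] at he
      obtain ⟨⟨hab, -⟩, hn⟩ := he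
      obtain ⟨v, w, hvw, hv, hw⟩ := hlift a b hab
      rw [Finset.mem_image]
      refine ⟨s(v, w), ?_, by rw [Sym2.map_mk, hv, hw]⟩
      have key : ∀ x y, x ∈ W.verts → π y = x → y ∈ S' := by
        intro x y hx hy
        by_cases hxS : x ∈ S
        · have : y ∈ S := by rw [← hπS, hy]; exact hxS
          exact Finset.mem_union_left _ this
        · rw [hout x hxS y hy]
          simp [S', Y, hx]
      rw [Finset.mem_sdiff, mk_mem_eIn, mk_mem_eIn]
      refine ⟨⟨hvw, key a v hab.fst_mem hv, key b w hab.snd_mem hw⟩, ?_⟩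
      rintro ⟨-, hvS, hwS⟩
      apply hn
      rw [← hv, ← hw, hπS, hπS]
      exact ⟨hvS, hwS⟩
    have h2 := (Finset.card_le_card h1).trans Finset.card_image_le
    have h3 := Finset.card_sdiff_add_card_eq_card (eIn_mono G (Finset.subset_union_left (s₁ := S) (s₂ := Y)))
    simp only [S'] at *
    omega
  have hpW := pot_coe W
  have hb := c5_bound (X.image f) (hXne.image f)
  rw [← eIn_c5, Finset.card_image_of_injOn hinjX] at hb
  obtain ⟨hb1, hb2⟩ := hb
  have hmain : pot W.coe ≤ 2 → pS G S' ≤ pS G S - 3 := by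
    intro hle
    unfold pS
    omega
  rcases hsmall with hs | ⟨⟨φ⟩⟩ | ⟨⟨φ⟩⟩ | ⟨⟨φ⟩⟩
  · exact Or.inl ⟨S', Finset.subset_union_left, hmain (by omega)⟩
  · -- the triangle
    have h3 := pot_iso φ
    have h3' := pot_C3
    have hc3 : Fintype.card W.verts = 3 := by
      rw [Fintype.card_congr φ.toEquiv, Fintype.card_fin]
    by_cases hX1 : 2 ≤ X.card
    · left
      refine ⟨S', Finset.subset_union_left, ?_⟩
      have := hb2 hX1 (by omega)
      unfold pS
      omega
    · right
      have hX1' := hXne.card_pos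
      have hY : Y.card = 2 := by omega
      obtain ⟨a, b, hab, hYab⟩ := Finset.card_eq_two.1 hY
      obtain ⟨x, hx⟩ := hXne
      have ha : a ∈ W.verts ∧ a ∉ S := by
        have : a ∈ Y := by rw [hYab]; simp
        simpa [Y] using this
      have hb : b ∈ W.verts ∧ b ∉ S := by
        have : b ∈ Y := by rw [hYab]; simp
        simpa [Y] using this
      have hx : x ∈ W.verts ∧ x ∈ S := by simpa [X] using hx
      have hadj : ∀ y (hy : y ∈ W.verts) z (hz : z ∈ W.verts), y ≠ z → W.Adj y z := by
        intro y hy z hz hyz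
        have : W.coe.Adj ⟨y, hy⟩ ⟨z, hz⟩ := by
          rw [← φ.map_adj_iff]
          have hne' : φ ⟨y, hy⟩ ≠ φ ⟨z, hz⟩ := by
            intro h
            exact hyz (congrArg Subtype.val (φ.injective h))
          generalize φ ⟨y, hy⟩ = p at *
          generalize φ ⟨z, hz⟩ = q at *
          revert p q
          decide
        simpa using this
      have h1 := hadj a ha.1 b hb.1 hab
      have h2 := hadj a ha.1 x hx.1 (fun e => ha.2 (e ▸ hx.2))
      have h3 := hadj b hb.1 x hx.1 (fun e => hb.2 (e ▸ hx.2))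
      obtain ⟨v, w, hvw, hv, hw⟩ := hlift _ _ h1
      rw [hout a ha.2 v hv, hout b hb.2 w hw] at hvw
      obtain ⟨v2, w2, hvw2, hv2, hw2⟩ := hlift _ _ h2
      rw [hout a ha.2 v2 hv2] at hvw2
      obtain ⟨v3, w3, hvw3, hv3, hw3⟩ := hlift _ _ h3
      rw [hout b hb.2 v3 hv3] at hvw3
      exact ⟨a, b, w2, w3, ha.2, hb.2, by rw [← hπS, hw2]; exact hx.2,
        by rw [← hπS, hw3]; exact hx.2, hvw, hvw2, hvw3⟩
  · exact Or.inl ⟨S', Finset.subset_union_left, hmain (by rw [pot_iso φ]; exact pot_E1)⟩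
  · exact Or.inl ⟨S', Finset.subset_union_left, hmain (by rw [pot_iso φ]; exact pot_E2)⟩

lemma three_edges {V : Type} [Fintype V] [DecidableEq V] {G : SimpleGraph V} (S : Finset V)
    {a b u v : V} (ha : a ∉ S) (hb : b ∉ S) (hu : u ∈ S) (hv : v ∈ S)
    (hab : G.Adj a b) (hau : G.Adj a u) (hbv : G.Adj b v) :
    (eIn G S).card + 3 ≤ (eIn G (insert a (insert b S))).card ∧
    ((eIn G (insert a (insert b S))).card ≤ (eIn G S).card + 3 →
      eIn G (insert a (insert b S)) = eIn G S ∪ {s(a, b), s(a, u), s(b, v)}) := by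
  have hne : a ≠ b := hab.ne
  have hau' : a ≠ u := hau.ne
  have hbv' : b ≠ v := hbv.ne
  have hav : a ≠ v := fun e => ha (e ▸ hv)
  have hbu : b ≠ u := fun e => hb (e ▸ hu)
  have h3 : ({s(a, b), s(a, u), s(b, v)} : Finset (Sym2 V)).card = 3 := by
    rw [Finset.card_eq_three]
    refine ⟨_, _, _, ?_, ?_, ?_, rfl⟩ <;> simp [Sym2.eq_iff] <;> tauto
  have hd : Disjoint (eIn G S) {s(a, b), s(a, u), s(b, v)} := by
    rw [Finset.disjoint_right]
    intro e he
    simp only [Finset.mem_insert, Finset.mem_singleton] at he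
    rcases he with rfl | rfl | rfl <;> rw [mk_mem_eIn] <;> tauto
  have hsub : eIn G S ∪ {s(a, b), s(a, u), s(b, v)} ⊆ eIn G (insert a (insert b S)) := by
    apply Finset.union_subset
    · exact eIn_mono G ((Finset.subset_insert _ _).trans (Finset.subset_insert _ _))
    · intro e he
      simp only [Finset.mem_insert, Finset.mem_singleton] at he
      rcases he with rfl | rfl | rfl <;> rw [mk_mem_eIn] <;> simp [*]
  have hc := Finset.card_le_card hsub
  rw [Finset.card_union_of_disjoint hd, h3] at hc
  refine ⟨hc, fun hle => ?_⟩
  symm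
  apply Finset.eq_of_subset_of_card_le hsub
  rw [Finset.card_union_of_disjoint hd, h3]
  exact hle

lemma pS_insert2 {V : Type} [Fintype V] [DecidableEq V] {G : SimpleGraph V} (S : Finset V)
    {a b : V} (ha : a ∉ S) (hb : b ∉ S) (hab : a ≠ b) :
    pS G (insert a (insert b S)) =
      5 * (S.card : ℤ) + 10 - 4 * ((eIn G (insert a (insert b S))).card : ℤ) := by
  unfold pS
  rw [Finset.card_insert_of_notMem (by simp [hab, ha]), Finset.card_insert_of_notMem hb]
  push_cast
  ring

lemma pot_ge4 {V : Type} [Fintype V] {G : SimpleGraph V} (h : SmallestCex G) (S : Finset V)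
    (hne : S.Nonempty) (hS : S ≠ Finset.univ) : 4 ≤ pS G S := by
  classical
  obtain ⟨T, hT, hmin⟩ := Finset.exists_min_image
    (Finset.univ.filter (fun S : Finset V => S.Nonempty ∧ S ≠ Finset.univ)) (pS G)
    ⟨S, by simp [hne, hS]⟩
  simp only [Finset.mem_filter, Finset.mem_univ, true_and] at hT hmin
  refine le_trans ?_ (hmin S ⟨hne, hS⟩)
  by_contra hlt
  have h2 : 2 ≤ pS G Finset.univ := by rw [← pot_eq]; exact h.2.2.2.2.1
  have key : ∀ T', T ⊆ T' → ¬ pS G T' ≤ pS G T - 2 := by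
    intro T' hTT' hle
    by_cases hu : T' = Finset.univ
    · rw [hu] at hle; omega
    · have := hmin T' ⟨hT.1.mono hTT', hu⟩
      omega
  rcases core h T hT.1 hT.2 (by omega) with ⟨T', hTT', hle⟩ |
    ⟨a, b, u, v, ha, hb, hu, hv, hab, hau, hbv⟩
  · exact key T' hTT' (by omega)
  · apply key (insert a (insert b T)) ((Finset.subset_insert _ _).trans (Finset.subset_insert _ _))
    rw [pS_insert2 T ha hb hab.ne]
    have := (three_edges T ha hb hu hv hab hau hbv).1
    unfold pS
    omega

lemma struct4 {V : Type} [Fintype V] {G : SimpleGraph V} (h : SmallestCex G) (S : Finset V)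
    (hne : S.Nonempty) (hS : S ≠ Finset.univ) (hp : pS G S ≤ 4) :
    ∃ a b u v, a ∉ S ∧ b ∉ S ∧ u ∈ S ∧ v ∈ S ∧ G.Adj a b ∧ G.Adj a u ∧ G.Adj b v ∧
      (∀ x, x = a ∨ x = b ∨ x ∈ S) ∧
      ∀ x y, G.Adj x y → (x ∈ S ∧ y ∈ S) ∨ s(x, y) = s(a, b) ∨ s(x, y) = s(a, u) ∨
        s(x, y) = s(b, v) := by
  classical
  have h4 := pot_ge4 h S hne hS
  have h2 : 2 ≤ pS G Finset.univ := by rw [← pot_eq]; exact h.2.2.2.2.1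
  rcases core h S hne hS hp with ⟨T', hTT', hle⟩ | ⟨a, b, u, v, ha, hb, hu, hv, hab, hau, hbv⟩
  · exfalso
    by_cases hu : T' = Finset.univ
    · rw [hu] at hle; omega
    · have := pot_ge4 h T' (hne.mono hTT') hu
      omega
  · refine ⟨a, b, u, v, ha, hb, hu, hv, hab, hau, hbv, ?_⟩
    have hp2 := pS_insert2 (G := G) S ha hb hab.ne
    have h3 := three_edges S ha hb hu hv hab hau hbv
    have huniv : insert a (insert b S) = Finset.univ := by
      by_contra hn
      have := pot_ge4 h _ (Finset.insert_nonempty a (insert b S)) hn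
      unfold pS at hp h4
      omega
    refine ⟨fun x => ?_, fun x y hxy => ?_⟩
    · have : x ∈ insert a (insert b S) := by rw [huniv]; exact Finset.mem_univ x
      simpa using this
    · have heq := h3.2 (by
        rw [← huniv, hp2] at h2
        unfold pS at hp h4
        omega)
      have : s(x, y) ∈ eIn G (insert a (insert b S)) := by
        rw [huniv, mk_mem_eIn]; simp [hxy]
      rw [heq, Finset.mem_union, mk_mem_eIn] at this
      simp only [Finset.mem_insert, Finset.mem_singleton] at this
      tauto

/-- Colorings of `S` extend over a path of length three joining differently colored vertices. -/
lemma ext_col {V : Type} [Fintype V] {G : SimpleGraph V} (S : Finset V) {a b u v : V}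
    (ha : a ∉ S) (hb : b ∉ S) (hu : u ∈ S) (hv : v ∈ S) (hab : a ≠ b)
    (hG : ∀ x y, G.Adj x y → (x ∈ S ∧ y ∈ S) ∨ s(x, y) = s(a, b) ∨ s(x, y) = s(a, u) ∨
        s(x, y) = s(b, v)) (c : V → Fin 5) (hc : GoodOn G S c) (huv : c u ≠ c v) :
    ∃ c : V → Fin 5, ∀ v w, G.Adj v w → (cycleGraph 5).Adj (c v) (c w) := by
  classical
  have hdec : ∀ x y : Fin 5, x ≠ y → ∃ p q : Fin 5, (cycleGraph 5).Adj x p ∧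
    (cycleGraph 5).Adj p q ∧ (cycleGraph 5).Adj q y := by decide
  obtain ⟨p, q, h1, h2, h3⟩ := hdec _ _ huv
  let c' : V → Fin 5 := fun x => if x = a then p else if x = b then q else c x
  have hca : c' a = p := if_pos rfl
  have hcb : c' b = q := by simp [c', hab.symm]
  have hcS : ∀ x ∈ S, c' x = c x := by
    intro x hx
    have : x ≠ a := fun e => ha (e ▸ hx)
    have : x ≠ b := fun e => hb (e ▸ hx)
    simp [c', *]
  refine ⟨c', fun x y hxy => ?_⟩
  rcases hG x y hxy with ⟨hx, hy⟩ | he | he | he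
  · rw [hcS x hx, hcS y hy]; exact hc x hx y hy hxy
  all_goals
    rw [Sym2.eq_iff] at he
    rcases he with ⟨rfl, rfl⟩ | ⟨rfl, rfl⟩
  · rw [hca, hcb]; exact h2
  · rw [hca, hcb]; exact h2.symm
  · rw [hca, hcS _ hu]; exact h1.symm
  · rw [hca, hcS _ hu]; exact h1
  · rw [hcb, hcS _ hv]; exact h3
  · rw [hcb, hcS _ hv]; exact h3.symm

lemma no_C3 {V : Type} [Fintype V] {G : SimpleGraph V} (h : SmallestCex G) {x y z : V}
    (hxy : G.Adj x y) (hyz : G.Adj y z) (hzx : G.Adj z x) : False := by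
  classical
  have n1 := hxy.ne
  have n2 := hyz.ne
  have n3 := hzx.ne
  have hc : ({x, y, z} : Finset V).card = 3 := Finset.card_eq_three.2 ⟨x, y, z, n1, n3.symm, n2, rfl⟩
  by_cases hu : ({x, y, z} : Finset V) = Finset.univ
  · have hall : ∀ p q : V, G.Adj p q ↔ p ≠ q := by
      intro p q
      refine ⟨fun h => h.ne, fun hpq => ?_⟩
      have hp : p ∈ ({x, y, z} : Finset V) := by rw [hu]; exact Finset.mem_univ _
      have hq : q ∈ ({x, y, z} : Finset V) := by rw [hu]; exact Finset.mem_univ _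
      simp only [Finset.mem_insert, Finset.mem_singleton] at hp hq
      rcases hp with rfl | rfl | rfl <;> rcases hq with rfl | rfl | rfl <;>
        first | exact absurd rfl hpq | assumption | (apply G.symm.symm; assumption)
    rw [hu, Finset.card_univ] at hc
    let e := Fintype.equivFinOfCardEq hc
    refine h.2.1.elim' ⟨e, ?_⟩
    intro p q
    rw [hall, ← e.injective.ne_iff]
    generalize e p = i
    generalize e q = j
    revert i j
    decide
  · have h4 := pot_ge4 h _ (Finset.insert_nonempty _ _) hu
    have : ({s(x, y), s(y, z), s(z, x)} : Finset (Sym2 V)) ⊆ eIn G {x, y, z} := by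
      intro e he
      simp only [Finset.mem_insert, Finset.mem_singleton] at he
      rcases he with rfl | rfl | rfl <;> rw [mk_mem_eIn] <;> simp [*]
    have h3 : ({s(x, y), s(y, z), s(z, x)} : Finset (Sym2 V)).card = 3 := by
      rw [Finset.card_eq_three]
      refine ⟨_, _, _, ?_, ?_, ?_, rfl⟩ <;> simp [Sym2.eq_iff] <;> tauto
    have := Finset.card_le_card this
    unfold pS at h4
    omega

lemma no_C4 {V : Type} [Fintype V] {G : SimpleGraph V} (h : SmallestCex G) {x y z w : V}
    (hxy : G.Adj x y) (hyz : G.Adj y z) (hzw : G.Adj z w) (hwx : G.Adj w x)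
    (hxz : x ≠ z) (hyw : y ≠ w) : False := by
  classical
  have n1 := hxy.ne
  have n2 := hyz.ne
  have n3 := hzw.ne
  have n4 := hwx.ne
  let S : Finset V := {x, y, z, w}
  have hSc : S.card = 4 := by
    simp only [S]
    rw [Finset.card_insert_of_notMem, Finset.card_insert_of_notMem, Finset.card_pair n3] <;>
      simp <;> tauto
  have hsub : ({s(x, y), s(y, z), s(z, w), s(w, x)} : Finset (Sym2 V)) ⊆ eIn G S := by
    intro e he
    simp only [Finset.mem_insert, Finset.mem_singleton] at he
    rcases he with rfl | rfl | rfl | rfl <;> rw [mk_mem_eIn] <;> simp [*, S]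
  have h4c : ({s(x, y), s(y, z), s(z, w), s(w, x)} : Finset (Sym2 V)).card = 4 := by
    rw [Finset.card_insert_of_notMem, Finset.card_insert_of_notMem, Finset.card_pair] <;>
      simp [Sym2.eq_iff] <;> tauto
  have hle := Finset.card_le_card hsub
  rw [h4c] at hle
  have hSne : S.Nonempty := Finset.insert_nonempty _ _
  have h2 : 2 ≤ pS G S := by
    by_cases hu : S = Finset.univ
    · rw [hu, ← pot_eq]; exact h.2.2.2.2.1
    · have := pot_ge4 h S hSne hu; omega
  have heq := Finset.eq_of_subset_of_card_le hsub (by rw [h4c]; unfold pS at h2; omega)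
  have hedge : ∀ p ∈ S, ∀ q ∈ S, G.Adj p q → s(p, q) = s(x, y) ∨ s(p, q) = s(y, z) ∨
      s(p, q) = s(z, w) ∨ s(p, q) = s(w, x) := by
    intro p hp q hq hpq
    have : s(p, q) ∈ eIn G S := by rw [mk_mem_eIn]; exact ⟨hpq, hp, hq⟩
    rw [← heq] at this
    simpa only [Finset.mem_insert, Finset.mem_singleton] using this
  let A : V → Fin 5 := fun v => if v = x then 0 else if v = z then 2 else 1
  let B : V → Fin 5 := fun v => if v = y then 0 else if v = w then 2 else 1
  have hAx : A x = 0 := by simp [A]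
  have hAz : A z = 2 := by simp [A, hxz.symm]
  have hAy : A y = 1 := by simp [A, n1.symm, n2]
  have hAw : A w = 1 := by simp [A, n4, n3.symm]
  have hBx : B x = 1 := by simp [B, n1, n4.symm]
  have hBz : B z = 1 := by simp [B, n2.symm, n3]
  have hBy : B y = 0 := by simp [B]
  have hBw : B w = 2 := by simp [B, hyw.symm]
  have hA : GoodOn G S A := by
    intro p hp q hq hpq
    have := hedge p hp q hq hpq
    simp only [Sym2.eq_iff] at this
    rcases this with (⟨rfl, rfl⟩ | ⟨rfl, rfl⟩) | (⟨rfl, rfl⟩ | ⟨rfl, rfl⟩) |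
      (⟨rfl, rfl⟩ | ⟨rfl, rfl⟩) | (⟨rfl, rfl⟩ | ⟨rfl, rfl⟩) <;>
      simp only [hAx, hAy, hAz, hAw] <;> decide
  have hB : GoodOn G S B := by
    intro p hp q hq hpq
    have := hedge p hp q hq hpq
    simp only [Sym2.eq_iff] at this
    rcases this with (⟨rfl, rfl⟩ | ⟨rfl, rfl⟩) | (⟨rfl, rfl⟩ | ⟨rfl, rfl⟩) |
      (⟨rfl, rfl⟩ | ⟨rfl, rfl⟩) | (⟨rfl, rfl⟩ | ⟨rfl, rfl⟩) <;>
      simp only [hBx, hBy, hBz, hBw] <;> decide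
  have hnc := (crit_iff.1 h.1).1
  by_cases hu : S = Finset.univ
  · exact hnc ⟨A, fun p q hpq => hA p (by rw [hu]; simp) q (by rw [hu]; simp) hpq⟩
  · obtain ⟨a, b, u, v, ha, hb, hu, hv, hab, hau, hbv, _, hG⟩ := struct4 h S hSne hu (by
      unfold pS; omega)
    have huv : u ≠ v := by
      rintro rfl
      exact no_C3 h hab hbv hau.symm
    by_cases hAuv : A u = A v
    · refine hnc (ext_col S ha hb hu hv hab.ne hG B hB ?_)
      simp only [S, Finset.mem_insert, Finset.mem_singleton] at hu hv
      rcases hu with rfl | rfl | rfl | rfl <;> rcases hv with rfl | rfl | rfl | rfl <;>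
        simp only [hAx, hAy, hAz, hAw, hBx, hBy, hBz, hBw] at * <;>
        first | exact absurd rfl huv | (revert hAuv; decide) | decide
    · exact hnc (ext_col S ha hb hu hv hab.ne hG A hA hAuv)

open Classical in
lemma min_deg {V : Type} [Fintype V] {G : SimpleGraph V} (T : Finset V)
    (hT : (eIn G T).card = T.card + 1) (hsp : ∀ S, S ⊂ T → (eIn G S).card ≤ S.card) (w : V)
    (hw : w ∈ T) : 2 ≤ (T.filter (fun x => G.Adj w x)).card := by
  have h1 := hsp (T.erase w) (Finset.erase_ssubset hw)
  have h2 := eIn_insert G (T.erase w) w (by simp)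
  rw [Finset.insert_erase hw] at h2
  have h3 := Finset.card_erase_add_one hw
  have h4 : ((T.erase w).filter (fun x => G.Adj w x)).card ≤ (T.filter (fun x => G.Adj w x)).card :=
    Finset.card_le_card (Finset.filter_subset_filter _ (Finset.erase_subset _ _))
  omega

lemma path_edges {V : Type} [Fintype V] [DecidableEq V] {G : SimpleGraph V} (l : List V)
    (hn : l.Nodup) (hc : l.IsChain G.Adj) : l.length ≤ (eIn G l.toFinset).card + 1 := by
  classical
  induction l with
  | nil => simp
  | cons x l ih =>
    rw [List.nodup_cons] at hn
    cases l with
    | nil => simp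
    | cons y l =>
      rw [List.isChain_cons_cons] at hc
      have := ih hn.2 hc.2
      rw [List.toFinset_cons]
      have h2 := eIn_insert G (y :: l).toFinset x (by simpa using hn.1)
      have h3 : 0 < ((y :: l).toFinset.filter (fun z => G.Adj x z)).card :=
        Finset.card_pos.2 ⟨y, by simp [hc.1]⟩
      rw [List.length_cons]
      have h4 : (eIn G (insert x (y :: l).toFinset)).card =
        (eIn G (y :: l).toFinset).card + ((y :: l).toFinset.filter (fun z => G.Adj x z)).card := by
        convert h2
      omega

/-- A sparse graph with `n+1` edges has a Hamiltonian path. -/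
lemma ham {V : Type} [Fintype V] [DecidableEq V] {G : SimpleGraph V} (T : Finset V)
    (hT : (eIn G T).card = T.card + 1) (hsp : ∀ S, S ⊂ T → (eIn G S).card ≤ S.card) :
    ∃ l : List V, l.Nodup ∧ l.IsChain G.Adj ∧ l.toFinset = T := by
  classical
  let P : List V → Prop := fun l => l.Nodup ∧ l.IsChain G.Adj ∧ l.toFinset ⊆ T
  obtain ⟨l, hl, hmax⟩ : ∃ l, P l ∧ ∀ l', P l' → l'.length ≤ l.length := by
    by_contra hcon
    push Not at hcon
    have hall : ∀ n : ℕ, ∃ l, P l ∧ n ≤ l.length := by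
      intro n
      induction n with
      | zero => exact ⟨[], ⟨by simp, by simp, by simp⟩, by simp⟩
      | succ n ih =>
        obtain ⟨l, hl, hn⟩ := ih
        obtain ⟨l', hl', hlt⟩ := hcon l hl
        exact ⟨l', hl', by omega⟩
    obtain ⟨l, hl, hn⟩ := hall (T.card + 1)
    have := Finset.card_le_card hl.2.2
    rw [List.toFinset_card_of_nodup hl.1] at this
    omega
  obtain ⟨hnd, hch, hsub⟩ := hl
  refine ⟨l, hnd, hch, ?_⟩
  by_contra hneT
  have hss : l.toFinset ⊂ T := hsub.ssubset_of_ne hneT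
  have hPc := hsp _ hss
  rw [List.toFinset_card_of_nodup hnd] at hPc
  have hdeg := min_deg T hT hsp
  -- neighbours of the first and last vertices
  have hfirst : ∀ x l', l = x :: l' → ∀ w ∈ T, G.Adj x w → w ∈ l := by
    intro x l' hl w hw hxw
    by_contra hwl
    have := hmax (w :: l) ⟨by simp [hwl, hnd], by
      rw [hl, List.isChain_cons_cons, ← hl]; exact ⟨hxw.symm, hch⟩, by
      rw [List.toFinset_cons]; exact Finset.insert_subset hw hsub⟩
    simp at this
  have hlast : ∀ y l', l = l' ++ [y] → ∀ w ∈ T, G.Adj y w → w ∈ l := by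
    intro y l' hl w hw hyw
    by_contra hwl
    have := hmax (l ++ [w]) ⟨by
      rw [List.nodup_append]
      refine ⟨hnd, by simp, ?_⟩
      intro a ha b hb
      rw [List.mem_singleton] at hb
      rw [hb]
      rintro rfl
      exact hwl ha, by
      rw [List.isChain_append]
      refine ⟨hch, by simp, ?_⟩
      intro a ha b hb
      rw [hl] at ha
      simp at ha hb
      rw [← ha, ← hb]; exact hyw, by
      rw [List.toFinset_append]
      exact Finset.union_subset hsub (by simpa using hw)⟩
    simp at this
  cases l with
  | nil =>
    have hTe : ∃ w, w ∈ T := by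
      by_contra hne
      push Not at hne
      have hT0 := Finset.eq_empty_of_forall_notMem hne
      apply hneT
      rw [hT0]; rfl
    obtain ⟨w, hw⟩ := hTe
    have := hmax [w] ⟨by simp, by simp, by simpa using hw⟩
    simp at this
  | cons x l' =>
    have hxT : x ∈ T := hsub (by simp)
    rcases List.eq_nil_or_concat' l' with rfl | ⟨mid, y, rfl⟩
    · obtain ⟨w, hw⟩ := Finset.card_pos.1 (lt_of_lt_of_le (by norm_num) (hdeg x hxT))
      rw [Finset.mem_filter] at hw
      have := hfirst x [] rfl w hw.1 hw.2
      rw [List.mem_singleton] at this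
      rw [this] at hw
      exact G.loopless.irrefl _ hw.2
    · have hyT : y ∈ T := hsub (by simp)
      by_cases hxy : G.Adj x y
      · -- the cycle case
        have hno : ∀ p ∈ x :: (mid ++ [y]), ∀ w ∈ T, w ∉ x :: (mid ++ [y]) → ¬ G.Adj p w := by
          intro p hp w hw hwl hpw
          obtain ⟨l1, l2, hl12⟩ := List.append_of_mem hp
          have hpe : (x :: (mid ++ [y])).Perm (p :: l2 ++ l1) := by
            rw [hl12]; exact List.perm_append_comm
          have := hmax (w :: (p :: l2 ++ l1)) ⟨by
            rw [List.nodup_cons, ← hpe.mem_iff, ← hpe.nodup_iff]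
            exact ⟨hwl, hnd⟩, by
            have hch' := hch
            rw [hl12, List.isChain_append] at hch'
            have h2 : List.IsChain G.Adj ((p :: l2) ++ l1) := by
              rw [List.isChain_append]
              refine ⟨hch'.2.1, hch'.1, ?_⟩
              intro a ha b hb
              have h3 : (x :: (mid ++ [y])).getLast? = (l1 ++ p :: l2).getLast? := by rw [hl12]
              have h4 : (x :: (mid ++ [y])).head? = (l1 ++ p :: l2).head? := by rw [hl12]
              rw [List.getLast?_append_cons] at h3
              have ha' : a = y := by
                rw [← h3, ← List.cons_append, List.getLast?_append] at ha
                simp at ha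
                exact ha.symm
              have hb' : b = x := by
                cases l1 with
                | nil => simp at hb
                | cons z l1 => simp at h4 hb; rw [← hb, h4]
              rw [ha', hb']
              exact hxy.symm
            rw [List.cons_append, List.isChain_cons_cons]
            exact ⟨hpw.symm, h2⟩, by
            rw [List.toFinset_cons, ← List.toFinset_eq_of_perm _ _ hpe]
            exact Finset.insert_subset hw hsub⟩
          have hlen := hpe.length_eq
          rw [List.length_cons, ← hlen] at this
          omega
        have hQ : T \ (x :: (mid ++ [y])).toFinset ⊂ T := by
          refine Finset.sdiff_subset.ssubset_of_ne ?_
          intro he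
          have : x ∈ T \ (x :: (mid ++ [y])).toFinset := by rw [he]; exact hxT
          simp at this
        have hQc := hsp _ hQ
        have hU : eIn G T ⊆ eIn G (x :: (mid ++ [y])).toFinset ∪
            eIn G (T \ (x :: (mid ++ [y])).toFinset) := by
          intro e he
          induction e with | _ a b =>
          rw [mk_mem_eIn] at he
          rw [Finset.mem_union, mk_mem_eIn, mk_mem_eIn]
          simp only [Finset.mem_sdiff, List.mem_toFinset]
          have h1 := hno a
          have h2 := hno b
          by_cases haP : a ∈ x :: (mid ++ [y])
          · by_cases hbP : b ∈ x :: (mid ++ [y])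
            · exact Or.inl ⟨he.1, haP, hbP⟩
            · exact absurd he.1 (h1 haP b he.2.2 hbP)
          · by_cases hbP : b ∈ x :: (mid ++ [y])
            · exact absurd he.1.symm (h2 hbP a he.2.1 haP)
            · exact Or.inr ⟨he.1, ⟨he.2.1, haP⟩, ⟨he.2.2, hbP⟩⟩
        have hUc := (Finset.card_le_card hU).trans (Finset.card_union_le _ _)
        have hsum := Finset.card_sdiff_add_card_eq_card hsub
        rw [List.toFinset_card_of_nodup hnd] at hsum
        omega
      · -- two different chords at the ends
        have hnd' := hnd
        rw [List.nodup_cons, List.nodup_append] at hnd'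
        obtain ⟨hx, hmid, -, hmy⟩ := hnd'
        have hymid : y ∉ mid := fun hy => hmy y hy y (by simp) rfl
        have hcm : mid.IsChain G.Adj := by
          have h1 : (x :: (mid ++ [y])) = [x] ++ (mid ++ [y]) := rfl
          rw [h1, List.isChain_append, List.isChain_append] at hch
          exact hch.2.1.1
        have hm := path_edges mid hmid hcm
        have e1 := eIn_insert G mid.toFinset y (by simpa using hymid)
        have e2 := eIn_insert G (insert y mid.toFinset) x (by
          simp only [Finset.mem_insert, List.mem_toFinset]
          simpa [or_comm] using hx)
        have d1 : (T.filter (fun w => G.Adj y w)).card ≤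
            (mid.toFinset.filter (fun w => G.Adj y w)).card := by
          apply Finset.card_le_card
          intro w hw
          rw [Finset.mem_filter] at hw ⊢
          refine ⟨?_, hw.2⟩
          have := hlast y (x :: mid) rfl w hw.1 hw.2
          simp only [List.mem_cons, List.mem_append, List.not_mem_nil, or_false] at this
          rcases this with rfl | h | rfl
          · exact absurd hw.2.symm hxy
          · simpa using h
          · exact absurd hw.2 (G.loopless.irrefl _)
        have d2 : (T.filter (fun w => G.Adj x w)).card ≤
            ((insert y mid.toFinset).filter (fun w => G.Adj x w)).card := by
          apply Finset.card_le_card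
          intro w hw
          rw [Finset.mem_filter] at hw ⊢
          refine ⟨?_, hw.2⟩
          have := hfirst x _ rfl w hw.1 hw.2
          simp only [List.mem_cons, List.mem_append, List.not_mem_nil, or_false] at this
          rcases this with rfl | h | rfl
          · exact absurd hw.2 (G.loopless.irrefl _)
          · simp [h]
          · simp
        have d3 := hdeg x hxT
        have d4 := hdeg y hyT
        have hset : (x :: (mid ++ [y])).toFinset = insert x (insert y mid.toFinset) := by
          ext w
          simp only [List.mem_toFinset, List.mem_cons, List.mem_append, List.not_mem_nil,
            or_false, Finset.mem_insert]
          tauto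
        rw [hset] at hPc
        simp only [List.length_cons, List.length_append, List.length_nil] at hPc
        have e1' : (eIn G (insert y mid.toFinset)).card =
          (eIn G mid.toFinset).card + (mid.toFinset.filter (fun z => G.Adj y z)).card := by
          convert e1
        have e2' : (eIn G (insert x (insert y mid.toFinset))).card =
          (eIn G (insert y mid.toFinset)).card +
            ((insert y mid.toFinset).filter (fun z => G.Adj x z)).card := by
          convert e2
        omega

/-- Adjacency of the path `0 1 2 ...` with the two chords `0 p` and `q r`. -/
def adjB (p q r x y : ℕ) : Bool :=
  x + 1 == y || y + 1 == x || (x == 0 && y == p) || (y == 0 && x == p) ||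
    (x == q && y == r) || (y == q && x == r)

/-- Coloring of the path determined by a bit mask of steps. -/
def colB (s : ℕ) : ℕ → ℕ
  | 0 => 0
  | n + 1 => (colB s n + (if s.testBit n then 1 else 4)) % 5

/-- Adjacency in the 5-cycle. -/
def a5 (x y : ℕ) : Bool := (x + 1) % 5 == y || (y + 1) % 5 == x

/-- There is a triangle or a 4-cycle. -/
def badB (m p q r : ℕ) : Bool :=
  (List.range m).any fun x => (List.range m).any fun y => adjB p q r x y &&
    (List.range m).any fun z => adjB p q r y z &&
      (adjB p q r z x || (x != z && (List.range m).any fun w => y != w && adjB p q r z w &&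
        adjB p q r w x))

/-- Admissible chords. -/
def admB (m p q r : ℕ) : Bool :=
  2 ≤ p && q + 2 ≤ r && !(q == 0 && r == p) && (p + 1 == m || r + 1 == m)

/-- The mask `s` gives a coloring. -/
def okB (p q r s : ℕ) : Bool :=
  a5 (colB s 0) (colB s p) && a5 (colB s q) (colB s r)

/-- The graph on ten vertices. -/
def adj10 (p q r u v x y : ℕ) : Bool :=
  (x < 8 && y < 8 && adjB p q r x y) || (x == 8 && y == 9) || (x == 9 && y == 8) ||
  (x == 8 && y == u) || (y == 8 && x == u) || (x == 9 && y == v) || (y == 9 && x == v)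

/-- Isomorphisms from `E1`. -/
def perms1 : List (List ℕ) := [[0, 1, 2, 3, 7, 6, 5, 9, 8, 4], [2, 1, 0, 7, 6, 5, 4, 9, 8, 3],
  [1, 0, 7, 6, 5, 4, 3, 9, 8, 2], [2, 1, 0, 7, 9, 8, 5, 4, 3, 6], [1, 0, 7, 6, 9, 8, 4, 3, 2, 5],
  [0, 1, 2, 3, 4, 5, 6, 9, 8, 7], [0, 7, 6, 5, 4, 3, 2, 9, 8, 1], [2, 1, 0, 4, 5, 6, 7, 9, 8, 3],
  [1, 2, 3, 4, 5, 6, 7, 9, 8, 0], [0, 1, 2, 3, 8, 9, 5, 6, 7, 4]]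

/-- Isomorphisms from `E2`. -/
def perms2 : List (List ℕ) := [[3, 7, 0, 1, 2, 6, 5, 4, 8, 9], [0, 4, 3, 2, 1, 5, 6, 7, 8, 9],
  [3, 4, 0, 1, 2, 5, 6, 7, 8, 9], [1, 5, 4, 3, 2, 6, 7, 0, 8, 9], [2, 6, 5, 4, 3, 7, 0, 1, 9, 8]]

/-- `τ` is an isomorphism from the graph with edge list `l`. -/
def isoB (l : List (ℕ × ℕ)) (p q r u v : ℕ) (τ : List ℕ) : Bool :=
  (List.range 10).all fun x => (List.range 10).all fun y =>
    (adj10 p q r u v (τ.getD x 0) (τ.getD y 0) == (l.contains (x, y) || l.contains (y, x)))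

/-- First check: a coloring exists or there is a short cycle. -/
def checkA (m : ℕ) : Bool :=
  (List.range m).all fun p => (List.range m).all fun q => (List.range m).all fun r =>
    !(admB m p q r) || (List.range (2 ^ (m - 1))).any (okB p q r) || badB m p q r

/-- Second check. -/
def checkB : Bool :=
  (List.range 8).all fun p => (List.range 8).all fun q => (List.range 8).all fun r =>
    !(admB 8 p q r) || (List.range 8).all fun u => (List.range 8).all fun v => !(u < v) ||
      ((List.range 128).any fun s => okB p q r s && (colB s u != colB s v)) || badB 8 p q r ||
      perms1.any (isoB l1 p q r u v) || perms2.any (isoB l2 p q r u v)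

lemma checkA6 : checkA 6 = true := by decide +kernel
lemma checkA7 : checkA 7 = true := by decide +kernel
lemma checkA8 : checkA 8 = true := by decide +kernel
lemma checkB8 : checkB = true := by decide +kernel

lemma colB_lt (s n : ℕ) : colB s n < 5 := by
  cases n with
  | zero => simp [colB]
  | succ n => exact Nat.mod_lt _ (by norm_num)

lemma colB_succ (s n : ℕ) : a5 (colB s n) (colB s (n + 1)) = true := by
  have h := colB_lt s n
  simp only [colB]
  generalize colB s n = k at *
  split_ifs <;> interval_cases k <;> decide

lemma a5_symm {x y : ℕ} (h : a5 x y = true) : a5 y x = true := by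
  unfold a5 at *; rw [Bool.or_comm]; exact h

lemma perms_ok : (∀ τ ∈ perms1, (∀ x < 10, τ.getD x 0 < 10) ∧
    (∀ x < 10, ∀ y < 10, τ.getD x 0 = τ.getD y 0 → x = y)) ∧
    (∀ τ ∈ perms2, (∀ x < 10, τ.getD x 0 < 10) ∧
    (∀ x < 10, ∀ y < 10, τ.getD x 0 = τ.getD y 0 → x = y)) := by decide +kernel

lemma a5_fin : ∀ x y : Fin 5, a5 x.1 y.1 = true → (cycleGraph 5).Adj x y := by decide +kernel

lemma colB_adj {p q r s x y : ℕ} (hs : okB p q r s = true) (h : adjB p q r x y = true) :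
    a5 (colB s x) (colB s y) = true := by
  unfold okB at hs
  unfold adjB at h
  simp only [Bool.and_eq_true, Bool.or_eq_true, beq_iff_eq] at hs h
  obtain ⟨h1, h2⟩ := hs
  rcases h with ((((rfl | rfl) | ⟨rfl, rfl⟩) | ⟨rfl, rfl⟩) | ⟨rfl, rfl⟩) | ⟨rfl, rfl⟩
  · exact colB_succ s x
  · exact a5_symm (colB_succ s y)
  · exact h1
  · exact a5_symm h1
  · exact h2
  · exact a5_symm h2

lemma adjB_lt {p q r x y : ℕ} (h : x < y) (hp : 0 < p) (hqr : q < r) :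
    adjB p q r x y = true ↔ (y = x + 1 ∨ (x = 0 ∧ y = p) ∨ (x = q ∧ y = r)) := by
  simp only [adjB, Bool.and_eq_true, Bool.or_eq_true, beq_iff_eq]
  constructor
  · rintro (((((h1 | h1) | h1) | h1) | h1) | h1)
    · exact Or.inl h1.symm
    · omega
    · exact Or.inr (Or.inl h1)
    · omega
    · exact Or.inr (Or.inr h1)
    · omega
  · rintro (h1 | h1 | h1)
    · exact Or.inl (Or.inl (Or.inl (Or.inl (Or.inl h1.symm))))
    · exact Or.inl (Or.inl (Or.inl (Or.inr h1)))
    · exact Or.inl (Or.inr h1)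

lemma adjB_self {p q r x : ℕ} (hp : 0 < p) (hqr : q < r) : ¬ adjB p q r x x = true := by
  simp only [adjB, Bool.and_eq_true, Bool.or_eq_true, beq_iff_eq]
  rintro (((((h1 | h1) | h1) | h1) | h1) | h1) <;> omega

lemma adjB_symm (p q r x y : ℕ) : adjB p q r x y = true ↔ adjB p q r y x = true := by
  simp only [adjB, Bool.and_eq_true, Bool.or_eq_true, beq_iff_eq]
  tauto

lemma admB_of {m p q r j : ℕ} (hp : 0 < p ∧ ¬ (0 + 1 < m ∧ p = 0 + 1)) (hqr : q < r)
    (hq2 : ¬ (q + 1 < m ∧ r = q + 1)) (hpm : p < m) (hr : r < m) (hne : ¬ (q = 0 ∧ r = p))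
    (hj : (j = 0 ∧ m - 1 = p) ∨ (j = q ∧ m - 1 = r)) : admB m p q r = true := by
  simp only [admB, Bool.and_eq_true, Bool.or_eq_true, decide_eq_true_eq, beq_iff_eq,
    Bool.not_eq_true', Bool.and_eq_false_iff, beq_eq_false_iff_ne]
  refine ⟨⟨⟨?_, ?_⟩, ?_⟩, ?_⟩
  · omega
  · omega
  · tauto
  · omega

set_option maxHeartbeats 1000000 in
open Classical in
lemma chords {V : Type} [Fintype V] {G : SimpleGraph V} (T : Finset V) (m : ℕ) (hm : 3 ≤ m)
    (t : ℕ → V) (hinj : ∀ x < m, ∀ y < m, t x = t y → x = y)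
    (hTt : T = (Finset.range m).image t) (hpath : ∀ x, x + 1 < m → G.Adj (t x) (t (x + 1)))
    (he : (eIn G T).card = m + 1)
    (hdeg : ∀ w ∈ T, 2 ≤ (T.filter (fun x => G.Adj w x)).card) :
    ∃ p < m, ∃ q < m, ∃ r < m, admB m p q r = true ∧
      ∀ x < m, ∀ y < m, G.Adj (t x) (t y) ↔ adjB p q r x y = true := by
  let E : Finset (ℕ × ℕ) := (Finset.range m ×ˢ Finset.range m).filter
    (fun z => z.1 < z.2 ∧ G.Adj (t z.1) (t z.2))
  have hE : ∀ x y, (x, y) ∈ E ↔ x < y ∧ y < m ∧ G.Adj (t x) (t y) := by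
    intro x y
    simp only [E, Finset.mem_filter, Finset.mem_product, Finset.mem_range]
    constructor
    · tauto
    · rintro ⟨h1, h2, h3⟩
      exact ⟨⟨by omega, h2⟩, h1, h3⟩
  have hEcard : E.card = m + 1 := by
    rw [← he]
    have himg : E.image (fun z => s(t z.1, t z.2)) = eIn G T := by
      ext e
      induction e with | _ a b =>
      rw [mk_mem_eIn, Finset.mem_image]
      constructor
      · rintro ⟨⟨x, y⟩, hz, hxy⟩
        rw [hE] at hz
        rw [← mk_mem_eIn, ← hxy, mk_mem_eIn, hTt]
        exact ⟨hz.2.2, Finset.mem_image_of_mem t (Finset.mem_range.2 (by omega)),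
          Finset.mem_image_of_mem t (Finset.mem_range.2 (by omega))⟩
      · rw [hTt]
        rintro ⟨hab, ha, hb⟩
        simp only [Finset.mem_image, Finset.mem_range] at ha hb
        obtain ⟨x, hx, rfl⟩ := ha
        obtain ⟨y, hy, rfl⟩ := hb
        rcases lt_trichotomy x y with h | h | h
        · exact ⟨(x, y), (hE x y).2 ⟨h, hy, hab⟩, rfl⟩
        · rw [h] at hab
          exact absurd hab (G.loopless.irrefl _)
        · exact ⟨(y, x), (hE y x).2 ⟨h, hx, hab.symm⟩, Sym2.eq_swap⟩
    rw [← himg, Finset.card_image_of_injOn]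
    rintro ⟨x, y⟩ h1 ⟨x', y'⟩ h2 h
    rw [Finset.mem_coe, hE] at h1 h2
    simp only [Sym2.eq_iff] at h
    rcases h with ⟨a, b⟩ | ⟨a, b⟩
    · rw [hinj x (by omega) x' (by omega) a, hinj y (by omega) y' (by omega) b]
    · have := hinj x (by omega) y' (by omega) a
      have := hinj y (by omega) x' (by omega) b
      omega
  let P : Finset (ℕ × ℕ) := (Finset.range (m - 1)).image (fun i => (i, i + 1))
  have hP : ∀ x y, (x, y) ∈ P ↔ x + 1 < m ∧ y = x + 1 := by
    intro x y
    simp only [P, Finset.mem_image, Finset.mem_range, Prod.mk.injEq]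
    constructor
    · rintro ⟨i, hi, rfl, rfl⟩; exact ⟨by omega, rfl⟩
    · rintro ⟨h, rfl⟩; exact ⟨x, by omega, rfl, rfl⟩
  have hPc : P.card = m - 1 := by
    rw [Finset.card_image_of_injective, Finset.card_range]
    intro i j h
    simp only [Prod.mk.injEq] at h
    exact h.1
  have hPE : P ⊆ E := by
    rintro ⟨x, y⟩ h
    rw [hP] at h
    rw [hE, h.2]
    exact ⟨by omega, h.1, hpath x h.1⟩
  have hCc : (E \ P).card = 2 := by
    rw [Finset.card_sdiff_of_subset hPE]; omega
  have htT : ∀ x < m, t x ∈ T := by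
    intro x hx
    rw [hTt]; exact Finset.mem_image_of_mem t (Finset.mem_range.2 hx)
  have hfirst : ∃ i, (0, i) ∈ E \ P := by
    obtain ⟨w, hw, hne⟩ := Finset.exists_mem_ne (lt_of_lt_of_le one_lt_two
      (hdeg (t 0) (htT 0 (by omega)))) (t 1)
    rw [Finset.mem_filter, hTt] at hw
    obtain ⟨hw, hadj⟩ := hw
    simp only [Finset.mem_image, Finset.mem_range] at hw
    obtain ⟨i, hi, rfl⟩ := hw
    refine ⟨i, ?_⟩
    rw [Finset.mem_sdiff, hE, hP]
    have h0 : i ≠ 0 := by rintro rfl; exact G.loopless.irrefl _ hadj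
    have h1 : i ≠ 1 := by rintro rfl; exact hne rfl
    exact ⟨⟨by omega, hi, hadj⟩, by omega⟩
  have hlast : ∃ j, (j, m - 1) ∈ E \ P := by
    obtain ⟨w, hw, hne⟩ := Finset.exists_mem_ne (lt_of_lt_of_le one_lt_two
      (hdeg (t (m - 1)) (htT (m - 1) (by omega)))) (t (m - 2))
    rw [Finset.mem_filter, hTt] at hw
    obtain ⟨hw, hadj⟩ := hw
    simp only [Finset.mem_image, Finset.mem_range] at hw
    obtain ⟨i, hi, rfl⟩ := hw
    refine ⟨i, ?_⟩
    rw [Finset.mem_sdiff, hE, hP]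
    have h0 : i ≠ m - 1 := by rintro rfl; exact G.loopless.irrefl _ hadj
    have h1 : i ≠ m - 2 := by rintro rfl; exact hne rfl
    exact ⟨⟨by omega, by omega, hadj.symm⟩, by omega⟩
  obtain ⟨p, hp⟩ := hfirst
  obtain ⟨j, hj⟩ := hlast
  obtain ⟨⟨q, r⟩, hC, hqr⟩ : ∃ z, E \ P = {(0, p), z} ∧ (0, p) ≠ z := by
    obtain ⟨y, z, hyz, hC⟩ := Finset.card_eq_two.1 hCc
    rw [hC] at hp
    simp only [Finset.mem_insert, Finset.mem_singleton] at hp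
    rcases hp with rfl | rfl
    · exact ⟨z, hC, hyz⟩
    · exact ⟨y, by rw [hC, Finset.pair_comm], hyz.symm⟩
  have hqrC : (q, r) ∈ E \ P := by rw [hC]; simp
  have hp' := hp
  have hqr' := hqrC
  rw [Finset.mem_sdiff, hE, hP] at hp' hqr'
  rw [hC] at hj
  simp only [Finset.mem_insert, Finset.mem_singleton, Prod.mk.injEq] at hj
  have hqr2 : ¬ (q = 0 ∧ r = p) := by
    rintro ⟨rfl, rfl⟩; exact hqr rfl
  have key : ∀ x y, x < y → y < m → (G.Adj (t x) (t y) ↔ (y = x + 1 ∨ (x = 0 ∧ y = p) ∨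
      (x = q ∧ y = r))) := by
    intro x y hxy hy
    have h1 : G.Adj (t x) (t y) ↔ (x, y) ∈ P ∪ (E \ P) := by
      rw [Finset.union_sdiff_of_subset hPE, hE]
      exact ⟨fun h => ⟨hxy, hy, h⟩, fun h => h.2.2⟩
    rw [h1, hC, Finset.mem_union, hP]
    simp only [Finset.mem_insert, Finset.mem_singleton, Prod.mk.injEq]
    constructor
    · rintro (h | h)
      · exact Or.inl h.2
      · exact Or.inr h
    · rintro (h | h)
      · exact Or.inl ⟨by omega, h⟩
      · exact Or.inr h
  obtain ⟨⟨hp1, hp2, -⟩, hp3⟩ := hp'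
  obtain ⟨⟨hq1, hq2, -⟩, hq3⟩ := hqr'
  refine ⟨p, hp2, q, hq1.trans hq2, r, hq2, ?_, ?_⟩
  · exact admB_of ⟨hp1, hp3⟩ hq1 hq3 hp2 hq2 hqr2 hj
  · intro x hx y hy
    rcases lt_trichotomy x y with h | h | h
    · rw [key x y h hy, adjB_lt h hp1 hq1]
    · subst h
      exact ⟨fun h => absurd h (G.loopless.irrefl _), fun h => absurd h (adjB_self hp1 hq1)⟩
    · rw [G.adj_comm, key y x h hx, adjB_symm, adjB_lt h hp1 hq1]

lemma bad_false {V : Type} [Fintype V] {G : SimpleGraph V} (h : SmallestCex G) {m p q r : ℕ}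
    (t : ℕ → V) (hinj : ∀ x < m, ∀ y < m, t x = t y → x = y)
    (hadj : ∀ x < m, ∀ y < m, G.Adj (t x) (t y) ↔ adjB p q r x y = true) :
    badB m p q r = false := by
  by_contra hb
  rw [Bool.not_eq_false] at hb
  simp only [badB, List.any_eq_true, List.mem_range, Bool.and_eq_true, Bool.or_eq_true,
    bne_iff_ne] at hb
  obtain ⟨x, hx, y, hy, hxy, z, hz, hyz, hrest⟩ := hb
  rw [← hadj x hx y hy] at hxy
  rw [← hadj y hy z hz] at hyz
  rcases hrest with hzx | ⟨hne, w, hw, ⟨hyw, hzw⟩, hwx⟩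
  · rw [← hadj z hz x hx] at hzx
    exact no_C3 h hxy hyz hzx
  · rw [← hadj z hz w hw] at hzw
    rw [← hadj w hw x hx] at hwx
    exact no_C4 h hxy hyz hzw hwx (fun e => hne (hinj x hx z hz e))
      (fun e => hyw (hinj y hy w hw e))

lemma mask_good {V : Type} {G : SimpleGraph V} [DecidableEq V] {T : Finset V} {m p q r : ℕ}
    (t : ℕ → V) (hinj : ∀ x < m, ∀ y < m, t x = t y → x = y)
    (hTt : T = (Finset.range m).image t)
    (hadj : ∀ x < m, ∀ y < m, G.Adj (t x) (t y) ↔ adjB p q r x y = true) (s : ℕ)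
    (hs : okB p q r s = true) :
    ∃ c : V → Fin 5, GoodOn G T c ∧ ∀ x < m, (c (t x)).1 = colB s x := by
  classical
  let c : V → Fin 5 := fun v => if hv : ∃ x < m, t x = v then ⟨colB s hv.choose, colB_lt _ _⟩ else 0
  have hc : ∀ x < m, (c (t x)).1 = colB s x := by
    intro x hx
    have hv : ∃ y < m, t y = t x := ⟨x, hx, rfl⟩
    have : c (t x) = ⟨colB s hv.choose, colB_lt _ _⟩ := dif_pos hv
    rw [this]
    simp only
    rw [hinj _ hv.choose_spec.1 x hx hv.choose_spec.2]
  refine ⟨c, ?_, hc⟩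
  intro v hv w hw hvw
  rw [hTt] at hv hw
  simp only [Finset.mem_image, Finset.mem_range] at hv hw
  obtain ⟨x, hx, rfl⟩ := hv
  obtain ⟨y, hy, rfl⟩ := hw
  apply a5_fin
  rw [hc x hx, hc y hy]
  exact colB_adj hs ((hadj x hx y hy).1 hvw)

lemma iso_of_perm {V : Type} [Fintype V] {G : SimpleGraph V} {K : SimpleGraph (Fin 10)}
    (l : List (ℕ × ℕ)) (hK : ∀ x y : Fin 10, K.Adj x y ↔ ((x.1, y.1) ∈ l ∨ (y.1, x.1) ∈ l))
    (φ : ℕ → V) (hφ : ∀ x < 10, ∀ y < 10, φ x = φ y → x = y) (hcard : Fintype.card V = 10)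
    {p q r u v : ℕ}
    (hadj : ∀ x < 10, ∀ y < 10, G.Adj (φ x) (φ y) ↔ adj10 p q r u v x y = true) (τ : List ℕ)
    (h1 : ∀ x < 10, τ.getD x 0 < 10)
    (h2 : ∀ x < 10, ∀ y < 10, τ.getD x 0 = τ.getD y 0 → x = y)
    (h3 : isoB l p q r u v τ = true) : Nonempty (G ≃g K) := by
  let g : Fin 10 → V := fun x => φ (τ.getD x.1 0)
  have hg : Function.Injective g := by
    intro x y hxy
    exact Fin.ext (h2 _ x.2 _ y.2 (hφ _ (h1 _ x.2) _ (h1 _ y.2) hxy))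
  have hb : Function.Bijective g := by
    rw [Fintype.bijective_iff_injective_and_card]
    exact ⟨hg, by rw [hcard, Fintype.card_fin]⟩
  let e := Equiv.ofBijective g hb
  have hiso : K ≃g G := ⟨e, by
    intro x y
    change G.Adj (φ _) (φ _) ↔ _
    rw [hadj _ (h1 _ x.2) _ (h1 _ y.2), hK]
    simp only [isoB, List.all_eq_true, List.mem_range, beq_iff_eq] at h3
    rw [h3 x.1 x.2 y.1 y.2]
    simp⟩
  exact ⟨hiso.symm⟩

lemma adj10_lt {p q r i j x y : ℕ} (hx : x < 8) (hy : y < 8) :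
    adj10 p q r i j x y = true ↔ adjB p q r x y = true := by
  have h1 : x ≠ 8 := by omega
  have h2 : x ≠ 9 := by omega
  have h3 : y ≠ 8 := by omega
  have h4 : y ≠ 9 := by omega
  simp [adj10, hx, hy, h1, h2, h3, h4]

lemma adj10_8 {p q r i j x : ℕ} (hx : x < 8) :
    adj10 p q r i j x 8 = true ↔ x = i := by
  have h1 : x ≠ 8 := by omega
  have h2 : x ≠ 9 := by omega
  simp [adj10, h1, h2]

lemma adj10_9 {p q r i j x : ℕ} (hx : x < 8) :
    adj10 p q r i j x 9 = true ↔ x = j := by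
  have h1 : x ≠ 8 := by omega
  have h2 : x ≠ 9 := by omega
  simp [adj10, h1, h2]

lemma adj10_symm (p q r i j x y : ℕ) :
    adj10 p q r i j x y = true ↔ adj10 p q r i j y x = true := by
  have h := adjB_symm p q r x y
  rw [← Bool.eq_iff_iff] at h ⊢
  simp only [adj10, h]
  rw [Bool.and_comm (decide (x < 8))]
  ac_rfl

lemma ten_false {V : Type} [Fintype V] [DecidableEq V] {G : SimpleGraph V} (h : SmallestCex G)
    {T : Finset V} {p q r : ℕ} (hp : p < 8) (hq : q < 8) (hr : r < 8)
    (t : ℕ → V) (hinj : ∀ x < 8, ∀ y < 8, t x = t y → x = y)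
    (hTt : T = (Finset.range 8).image t)
    (hadm : admB 8 p q r = true)
    (hadj : ∀ x < 8, ∀ y < 8, G.Adj (t x) (t y) ↔ adjB p q r x y = true)
    {a b : V} (ha : a ∉ T) (hb : b ∉ T) (hab : G.Adj a b)
    {i j : ℕ} (hij : i < j) (hj : j < 8) (hai : G.Adj a (t i)) (hbj : G.Adj b (t j))
    (hall : ∀ x, x = a ∨ x = b ∨ x ∈ T)
    (hG : ∀ x y, G.Adj x y → (x ∈ T ∧ y ∈ T) ∨ s(x, y) = s(a, b) ∨ s(x, y) = s(a, t i) ∨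
        s(x, y) = s(b, t j)) : False := by
  have hi : i < 8 := hij.trans hj
  have htT : ∀ x < 8, t x ∈ T := by
    intro x hx
    rw [hTt]; exact Finset.mem_image_of_mem t (Finset.mem_range.2 hx)
  have hta : ∀ x < 8, t x ≠ a := fun x hx e => ha (e ▸ htT x hx)
  have htb : ∀ x < 8, t x ≠ b := fun x hx e => hb (e ▸ htT x hx)
  have hbad := bad_false h t hinj hadj
  have hB := checkB8
  simp only [checkB, List.all_eq_true, List.mem_range] at hB
  have hB1 := hB p hp q hq r hr
  rw [hadm] at hB1
  simp only [Bool.not_true, Bool.false_or, List.all_eq_true, List.mem_range] at hB1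
  have hB2 := hB1 i hi j hj
  rw [hbad] at hB2
  simp only [hij, decide_true, Bool.not_true, Bool.false_or, Bool.or_false, Bool.or_eq_true,
    List.any_eq_true, List.mem_range, Bool.and_eq_true, bne_iff_ne] at hB2
  let φ : ℕ → V := fun n => if n < 8 then t n else if n = 8 then a else b
  have hφt : ∀ x < 8, φ x = t x := fun x hx => if_pos hx
  have hφa : φ 8 = a := rfl
  have hφb : φ 9 = b := rfl
  have h10 : ∀ x < 10, x < 8 ∨ x = 8 ∨ x = 9 := by intro x hx; omega
  have hφ : ∀ x < 10, ∀ y < 10, φ x = φ y → x = y := by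
    intro x hx y hy hxy
    rcases h10 x hx with hx | rfl | rfl <;> rcases h10 y hy with hy | rfl | rfl
    · rw [hφt x hx, hφt y hy] at hxy; exact hinj x hx y hy hxy
    · rw [hφt x hx, hφa] at hxy; exact absurd hxy (hta x hx)
    · rw [hφt x hx, hφb] at hxy; exact absurd hxy (htb x hx)
    · rw [hφt y hy, hφa] at hxy; exact absurd hxy.symm (hta y hy)
    · rfl
    · exact absurd hxy hab.ne
    · rw [hφt y hy, hφb] at hxy; exact absurd hxy.symm (htb y hy)
    · exact absurd hxy hab.ne.symm
    · rfl
  have hTc : T.card = 8 := by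
    rw [hTt, Finset.card_image_of_injOn, Finset.card_range]
    intro x hx y hy hxy
    simp only [Finset.coe_range, Set.mem_Iio] at hx hy
    exact hinj x hx y hy hxy
  have hcard : Fintype.card V = 10 := by
    have : (Finset.univ : Finset V) = insert a (insert b T) := by
      ext x; simpa using hall x
    rw [← Finset.card_univ, this, Finset.card_insert_of_notMem, Finset.card_insert_of_notMem hb,
      hTc]
    simp [ha, hab.ne]
  have hadja : ∀ x < 8, G.Adj (t x) a ↔ x = i := by
    intro x hx
    constructor
    · intro e
      rcases hG _ _ e with e | e | e | e
      · exact absurd e.2 ha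
      · rw [Sym2.eq_iff] at e
        rcases e with e | e
        · exact absurd e.1 (hta x hx)
        · exact absurd e.1 (htb x hx)
      · rw [Sym2.eq_iff] at e
        rcases e with e | e
        · exact absurd e.1 (hta x hx)
        · exact hinj x hx i hi e.1
      · rw [Sym2.eq_iff] at e
        rcases e with e | e
        · exact absurd e.1 (htb x hx)
        · exact absurd e.2 hab.ne
    · rintro rfl; exact hai.symm
  have hadjb : ∀ x < 8, G.Adj (t x) b ↔ x = j := by
    intro x hx
    constructor
    · intro e
      rcases hG _ _ e with e | e | e | e
      · exact absurd e.2 hb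
      · rw [Sym2.eq_iff] at e
        rcases e with e | e
        · exact absurd e.1 (hta x hx)
        · exact absurd e.1 (htb x hx)
      · rw [Sym2.eq_iff] at e
        rcases e with e | e
        · exact absurd e.1 (hta x hx)
        · exact absurd e.2 hab.ne.symm
      · rw [Sym2.eq_iff] at e
        rcases e with e | e
        · exact absurd e.1 (htb x hx)
        · exact hinj x hx j hj e.1
    · rintro rfl; exact hbj.symm
  have n1 : i ≠ 8 := by omega
  have n2 : i ≠ 9 := by omega
  have n3 : j ≠ 8 := by omega
  have n4 : j ≠ 9 := by omega
  have hadj10 : ∀ x < 10, ∀ y < 10, G.Adj (φ x) (φ y) ↔ adj10 p q r i j x y = true := by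
    intro x hx y hy
    rcases h10 x hx with hx | rfl | rfl <;> rcases h10 y hy with hy | rfl | rfl
    · rw [hφt x hx, hφt y hy, adj10_lt hx hy]; exact hadj x hx y hy
    · rw [hφt x hx, hφa, adj10_8 hx]; exact hadja x hx
    · rw [hφt x hx, hφb, adj10_9 hx]; exact hadjb x hx
    · rw [hφt y hy, hφa, adj10_symm, adj10_8 hy, G.adj_comm]; exact hadja y hy
    · rw [hφa]; simp [adj10, n1.symm]
    · rw [hφa, hφb]; simp [adj10, hab]
    · rw [hφt y hy, hφb, adj10_symm, adj10_9 hy, G.adj_comm]; exact hadjb y hy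
    · rw [hφa, hφb]; simp [adj10, hab.symm]
    · rw [hφb]; simp [adj10, n4.symm]
  rcases hB2 with (⟨s, -, hs, hne⟩ | ⟨τ, hτ, hiso⟩) | ⟨τ, hτ, hiso⟩
  · obtain ⟨c, hc, hcs⟩ := mask_good t hinj hTt hadj s hs
    refine (crit_iff.1 h.1).1 (ext_col T ha hb (htT i hi) (htT j hj) hab.ne hG c hc ?_)
    intro e
    apply hne
    rw [← hcs i hi, ← hcs j hj, e]
  · obtain ⟨e⟩ := iso_of_perm l1 E1_adj φ hφ hcard hadj10 τ (perms_ok.1 τ hτ).1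
      (perms_ok.1 τ hτ).2 hiso
    exact h.2.2.1.false e
  · obtain ⟨e⟩ := iso_of_perm l2 E2_adj φ hφ hcard hadj10 τ (perms_ok.2 τ hτ).1
      (perms_ok.2 τ hτ).2 hiso
    exact h.2.2.2.1.false e

lemma checkA_use {m p q r : ℕ} (hA : checkA m = true) (hp : p < m) (hq : q < m) (hr : r < m)
    (hadm : admB m p q r = true) (hbad : badB m p q r = false) : ∃ s, okB p q r s = true := by
  simp only [checkA, List.all_eq_true, List.mem_range] at hA
  have h1 := hA p hp q hq r hr
  rw [hadm, hbad] at h1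
  simp only [Bool.not_true, Bool.false_or, Bool.or_false, List.any_eq_true] at h1
  obtain ⟨s, -, hs⟩ := h1
  exact ⟨s, hs⟩

lemma eIn_empty {V : Type} [Fintype V] (G : SimpleGraph V) : (eIn G ∅).card = 0 := by
  rw [Finset.card_eq_zero, Finset.eq_empty_iff_forall_notMem]
  intro e
  induction e with | _ a b =>
  rw [mk_mem_eIn]
  simp

lemma dense_false {V : Type} [Fintype V] {G : SimpleGraph V} (h : SmallestCex G)
    (T : Finset V) (hT8 : T.card ≤ 8) (hTe : T.card + 1 ≤ (eIn G T).card) : False := by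
  classical
  have hne : T.Nonempty := by
    rw [Finset.nonempty_iff_ne_empty]
    rintro rfl
    rw [eIn_empty] at hTe
    omega
  have hsp : ∀ S, S ⊂ T → (eIn G S).card ≤ S.card := by
    intro S hS
    rcases S.eq_empty_or_nonempty with rfl | hSne
    · rw [eIn_empty]; exact Nat.zero_le _
    · have hSu : S ≠ Finset.univ := by
        rintro rfl
        exact hS.2 (Finset.subset_univ _)
      have h4 := pot_ge4 h S hSne hSu
      have hc := Finset.card_lt_card hS
      unfold pS at h4
      omega
  have h2 : 2 ≤ pS G T := by
    by_cases hu : T = Finset.univ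
    · rw [hu, ← pot_eq]; exact h.2.2.2.2.1
    · exact le_trans (by norm_num) (pot_ge4 h T hne hu)
  have h2' := h2
  unfold pS at h2'
  have he : (eIn G T).card = T.card + 1 := by omega
  have h6 : 6 ≤ T.card := by omega
  obtain ⟨l, hl1, hl2, hl3⟩ := ham T he hsp
  obtain ⟨m, hm⟩ : ∃ m, m = T.card := ⟨_, rfl⟩
  have hlm : l.length = m := by
    rw [hm, ← hl3, List.toFinset_card_of_nodup hl1]
  obtain ⟨v0, hv0⟩ := hne
  let t : ℕ → V := fun n => l.getD n v0
  have ht : ∀ n (hn : n < m), t n = l[n]'(by omega) := by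
    intro n hn
    exact List.getD_eq_getElem _ _ (by omega)
  have hinj : ∀ x < m, ∀ y < m, t x = t y → x = y := by
    intro x hx y hy hxy
    rw [ht x hx, ht y hy] at hxy
    exact (List.Nodup.getElem_inj_iff hl1).1 hxy
  have hTt : T = (Finset.range m).image t := by
    ext v
    rw [← hl3, List.mem_toFinset, List.mem_iff_getElem]
    simp only [Finset.mem_image, Finset.mem_range]
    constructor
    · rintro ⟨n, hn, rfl⟩
      exact ⟨n, by omega, ht n (by omega)⟩
    · rintro ⟨n, hn, rfl⟩
      exact ⟨n, by omega, (ht n hn).symm⟩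
  have hpath : ∀ x, x + 1 < m → G.Adj (t x) (t (x + 1)) := by
    intro x hx
    rw [ht x (by omega), ht (x + 1) hx]
    exact List.isChain_iff_getElem.1 hl2 x (by omega)
  obtain ⟨p, hp, q, hq, r, hr, hadm, hadj⟩ := chords T m (by omega) t hinj hTt hpath
    (by omega) (min_deg T he hsp)
  have hbad := bad_false h t hinj hadj
  by_cases hu : T = Finset.univ
  · have hA : checkA m = true := by
      have : m = 6 ∨ m = 7 ∨ m = 8 := by omega
      rcases this with rfl | rfl | rfl
      · exact checkA6
      · exact checkA7
      · exact checkA8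
    obtain ⟨s, hs⟩ := checkA_use hA hp hq hr hadm hbad
    obtain ⟨c, hc, -⟩ := mask_good t hinj hTt hadj s hs
    refine (crit_iff.1 h.1).1 ⟨c, fun v w hvw => hc v ?_ w ?_ hvw⟩
    · rw [hu]; exact Finset.mem_univ _
    · rw [hu]; exact Finset.mem_univ _
  · have hne : T.Nonempty := ⟨v0, hv0⟩
    have h4 := pot_ge4 h T hne hu
    have h4' := h4
    unfold pS at h4'
    have hm8 : m = 8 := by omega
    subst hm8
    obtain ⟨a, b, u, v, ha, hb, huT, hvT, hab, hau, hbv, hall, hG⟩ :=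
      struct4 h T hne hu (by unfold pS; omega)
    have huv : u ≠ v := by
      rintro rfl
      exact no_C3 h hab hbv hau.symm
    rw [hTt] at huT hvT
    simp only [Finset.mem_image, Finset.mem_range] at huT hvT
    obtain ⟨i, hi, rfl⟩ := huT
    obtain ⟨j, hj, rfl⟩ := hvT
    rcases lt_trichotomy i j with hij | hij | hij
    · exact ten_false h hp hq hr t hinj hTt hadm hadj ha hb hab hij hj hau hbv hall hG
    · exact huv (by rw [hij])
    · refine ten_false h hp hq hr t hinj hTt hadm hadj hb ha hab.symm hij hi hbv hau ?_ ?_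
      · intro x
        rcases hall x with e | e | e
        · exact Or.inr (Or.inl e)
        · exact Or.inl e
        · exact Or.inr (Or.inr e)
      · intro x y hxy
        rcases hG x y hxy with e | e | e | e
        · exact Or.inl e
        · exact Or.inr (Or.inl (e.trans Sym2.eq_swap))
        · exact Or.inr (Or.inr (Or.inr e))
        · exact Or.inr (Or.inr (Or.inl e))

lemma cyc_card {V : Type} [DecidableEq V] {G : SimpleGraph V} {u : V} {c : G.Walk u u}
    (hc : c.IsCycle) : c.support.toFinset.card = c.length := by
  have h1 : c.support = u :: c.support.tail := (Walk.cons_tail_support c).symm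
  have h2 : u ∈ c.support.tail := Walk.end_mem_tail_support hc.not_nil
  have h3 : c.support.toFinset = c.support.tail.toFinset := by
    rw [h1, List.toFinset_cons, Finset.insert_eq_of_mem]
    · rfl
    · rw [List.mem_toFinset]; exact h2
  rw [h3, List.toFinset_card_of_nodup hc.support_nodup, List.length_tail, Walk.length_support]
  rfl

lemma cyc_edges_sub {V : Type} [Fintype V] [DecidableEq V] {G : SimpleGraph V} {u : V}
    (c : G.Walk u u) : c.edges.toFinset ⊆ eIn G c.support.toFinset := by
  intro e he
  rw [List.mem_toFinset] at he
  induction e with | _ a b =>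
  rw [mk_mem_eIn, List.mem_toFinset, List.mem_toFinset]
  exact ⟨c.adj_of_mem_edges he, c.fst_mem_support_of_mem_edges he,
    c.snd_mem_support_of_mem_edges he⟩

lemma cyc_edges_card {V : Type} [DecidableEq V] {G : SimpleGraph V} {u : V}
    {c : G.Walk u u} (hc : c.IsCycle) : c.edges.toFinset.card = c.length := by
  rw [List.toFinset_card_of_nodup hc.edges_nodup, Walk.length_edges]

lemma cyc_boundary {V : Type} [DecidableEq V] {G : SimpleGraph V} {u : V} (c : G.Walk u u)
    (A : Finset V) {x y : V} (hx : x ∈ c.support) (hxA : x ∈ A) (hy : y ∈ c.support)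
    (hyA : y ∉ A) : ∃ d ∈ c.darts, d.fst ∉ A ∧ d.snd ∈ A := by
  by_cases hu : u ∈ A
  · obtain ⟨d, hd, h1, h2⟩ := (c.dropUntil y hy).exists_boundary_dart {z | z ∉ A} hyA
      (fun h => h hu)
    exact ⟨d, c.darts_dropUntil_subset_darts hy hd, h1, not_not.1 h2⟩
  · obtain ⟨d, hd, h1, h2⟩ := (c.takeUntil x hx).exists_boundary_dart {z | z ∉ A} hu
      (fun h => h hxA)
    exact ⟨d, c.darts_takeUntil_subset_darts hx hd, h1, not_not.1 h2⟩

lemma cyc_cut {V : Type} [Fintype V] [DecidableEq V] {G : SimpleGraph V} {u : V} {c : G.Walk u u}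
    (hc : c.IsCycle) (hE : eIn G c.support.toFinset ⊆ c.edges.toFinset) (A : Finset V)
    (hA : A ⊂ c.support.toFinset) (hne : A.Nonempty) : (eIn G A).card + 1 ≤ A.card := by
  classical
  obtain ⟨x, hxA⟩ := hne
  obtain ⟨y, hy, hyA⟩ := Finset.exists_of_ssubset hA
  have hx := hA.1 hxA
  rw [List.mem_toFinset] at hx hy
  obtain ⟨d0, hd0, h1, h2⟩ := cyc_boundary c A hx hxA hy hyA
  have hnd : (c.darts.map (fun d => d.snd)).Nodup := by
    rw [Walk.map_snd_darts]; exact hc.support_nodup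
  have hinj : ∀ d ∈ c.darts, ∀ d' ∈ c.darts, d.snd = d'.snd → d = d' :=
    fun d hd d' hd' e => List.inj_on_of_nodup_map hnd hd hd' e
  let D := c.darts.toFinset.filter (fun d => d.fst ∈ A ∧ d.snd ∈ A)
  have hD : ∀ d, d ∈ D ↔ d ∈ c.darts ∧ d.fst ∈ A ∧ d.snd ∈ A := by
    intro d; simp [D]
  have hle1 : (eIn G A).card ≤ D.card := by
    refine le_trans (Finset.card_le_card ?_) (Finset.card_image_le (s := D) (f := fun d => d.edge))
    intro e he
    have he2 := hE (eIn_mono G hA.1 he)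
    rw [List.mem_toFinset, Walk.edges, List.mem_map] at he2
    obtain ⟨d, hd, rfl⟩ := he2
    rw [Finset.mem_image]
    refine ⟨d, ?_, rfl⟩
    rw [hD]
    rw [mem_eIn] at he
    exact ⟨hd, he.2 _ (Sym2.mem_mk_left _ _), he.2 _ (Sym2.mem_mk_right _ _)⟩
  have hle2 : D.card ≤ (A.erase d0.snd).card := by
    apply Finset.card_le_card_of_injOn (fun d => d.snd)
    · intro d hd
      rw [Finset.mem_coe, hD] at hd
      rw [Finset.mem_coe, Finset.mem_erase]
      refine ⟨fun e => ?_, hd.2.2⟩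
      have := hinj d hd.1 d0 hd0 e
      rw [← this] at h1
      exact h1 hd.2.1
    · intro d hd d' hd' e
      rw [Finset.mem_coe, hD] at hd hd'
      exact hinj d hd.1 d' hd'.1 e
  have := Finset.card_erase_add_one h2
  omega

lemma cyc_len {V : Type} [Fintype V] {G : SimpleGraph V} (h : SmallestCex G) {u : V}
    {c : G.Walk u u} (hc : c.IsCycle) : 5 ≤ c.length := by
  by_contra hlt
  have h3 := hc.three_le_length
  have hadj : ∀ i, i < c.length → G.Adj (c.getVert i) (c.getVert (i + 1)) :=
    fun i hi => c.adj_getVert_succ hi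
  have hend : c.getVert c.length = c.getVert 0 := by
    rw [Walk.getVert_length, Walk.getVert_zero]
  have h01 := hadj 0 (by omega)
  have h12 := hadj 1 (by omega)
  have h23 := hadj 2 (by omega)
  have : c.length = 3 ∨ c.length = 4 := by omega
  rcases this with h' | h'
  · rw [h'] at hend
    rw [show 2 + 1 = 3 from rfl, hend] at h23
    exact no_C3 h h01 h12 h23
  · have h34 := hadj 3 (by omega)
    rw [h'] at hend
    rw [show 3 + 1 = 4 from rfl, hend] at h34
    refine no_C4 h h01 h12 h23 h34 ?_ ?_
    · intro e
      have := hc.getVert_injOn' (by simp) (by simp only [Set.mem_ofPred_eq]; omega) e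
      omega
    · intro e
      have := hc.getVert_injOn' (by simp only [Set.mem_ofPred_eq]; omega)
        (by simp only [Set.mem_ofPred_eq]; omega) e
      omega

lemma two_cycles {V : Type} [Fintype V] [DecidableEq V] {G : SimpleGraph V} (h : SmallestCex G)
    {u1 u2 : V} {c1 : G.Walk u1 u1} {c2 : G.Walk u2 u2} (h1 : c1.IsCycle) (h2 : c2.IsCycle)
    (hne : {e | e ∈ c1.edges} ≠ {e | e ∈ c2.edges}) :
    9 ≤ (c1.support.toFinset ∪ c2.support.toFinset).card := by
  by_contra hlt
  have hsub1 := Finset.card_le_card (Finset.subset_union_left (s₁ := c1.support.toFinset)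
    (s₂ := c2.support.toFinset))
  have hsub2 := Finset.card_le_card (Finset.subset_union_right (s₁ := c1.support.toFinset)
    (s₂ := c2.support.toFinset))
  have full : ∀ {u : V} {c : G.Walk u u}, c.IsCycle → c.support.toFinset.card ≤ 8 →
      c.edges.toFinset = eIn G c.support.toFinset := by
    intro u c hc hc8
    apply Finset.eq_of_subset_of_card_le (cyc_edges_sub c)
    by_contra hlt
    rw [cyc_edges_card hc, ← cyc_card hc] at hlt
    exact dense_false h _ hc8 (by omega)
  have f1 := full h1 (by omega)
  have f2 := full h2 (by omega)
  have e1 : (eIn G c1.support.toFinset).card = c1.support.toFinset.card := by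
    rw [← f1, cyc_edges_card h1, cyc_card h1]
  have e2 : (eIn G c2.support.toFinset).card = c2.support.toFinset.card := by
    rw [← f2, cyc_edges_card h2, cyc_card h2]
  have l1 := cyc_len h h1
  have l2 := cyc_len h h2
  rw [← cyc_card h1] at l1
  rw [← cyc_card h2] at l2
  have hnT : c1.support.toFinset ≠ c2.support.toFinset := by
    intro e
    apply hne
    rw [e, ← f2] at f1
    ext z
    have := Finset.ext_iff.1 f1 z
    simpa using this
  have hsum := Finset.card_union_add_card_inter c1.support.toFinset c2.support.toFinset
  have hsm := eIn_submod G c1.support.toFinset c2.support.toFinset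
  have hI : (c1.support.toFinset ∩ c2.support.toFinset).Nonempty := by
    rw [← Finset.card_pos]; omega
  by_cases hA : c1.support.toFinset ⊆ c2.support.toFinset
  · have := cyc_cut h2 f2.ge _ (Finset.ssubset_iff_subset_ne.2 ⟨hA, hnT⟩)
      (Finset.card_pos.1 (by omega))
    omega
  · have := cyc_cut h1 f1.ge (c1.support.toFinset ∩ c2.support.toFinset)
      (Finset.ssubset_iff_subset_ne.2 ⟨Finset.inter_subset_left,
        fun e => hA (Finset.inter_eq_left.1 e)⟩) hI
    exact dense_false h (c1.support.toFinset ∪ c2.support.toFinset) (by omega) (by omega)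

end TwoCyclesAux
/-- Every subgraph of a smallest counterexample containing two distinct
cycles has at least 9 vertices; in particular, any two distinct 5-cycles in a smallest
counterexample are edge-disjoint. -/
theorem smallestCex_two_cycles_nine_vertices {V : Type} [Fintype V] (G : SimpleGraph V)
    (h : SmallestCex G) :
    (∀ H : G.Subgraph, TwoDistinctCycles H.coe → 9 ≤ H.verts.ncard) ∧
    (∀ (v1 v2 : V) (c1 : G.Walk v1 v1) (c2 : G.Walk v2 v2),
      c1.IsCycle → c2.IsCycle → c1.length = 5 → c2.length = 5 →
      {e | e ∈ c1.edges} ≠ {e | e ∈ c2.edges} →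
      ∀ e, e ∈ c1.edges → e ∉ c2.edges) := by
  classical
  constructor
  · rintro H ⟨v1, v2, c1, c2, h1, h2, hne⟩
    have hinj : Function.Injective H.hom := H.hom_injective
    have k1 := (Walk.isCycle_map_iff_of_injective hinj).2 h1
    have k2 := (Walk.isCycle_map_iff_of_injective hinj).2 h2
    have hsub : ∀ {v : H.verts} (c : H.coe.Walk v v),
        ∀ x ∈ (c.map H.hom).support, x ∈ H.verts := by
      intro v c x hx
      rw [Walk.support_map, List.mem_map] at hx
      obtain ⟨y, -, rfl⟩ := hx
      exact y.2
    have hedge : ∀ {v : H.verts} (c : H.coe.Walk v v) (e : Sym2 H.verts),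
        e.map H.hom ∈ (c.map H.hom).edges ↔ e ∈ c.edges := by
      intro v c e
      rw [Walk.edges_map, List.mem_map_of_injective (Sym2.map.injective hinj)]
    have h9 := two_cycles h k1 k2 (by
      intro he
      apply hne
      ext e
      have := Set.ext_iff.1 he (e.map H.hom)
      simp only [Set.mem_ofPred_eq] at this ⊢
      rwa [hedge, hedge] at this)
    refine le_trans h9 ?_
    rw [← Set.ncard_coe_finset]
    apply Set.ncard_le_ncard _ (Set.toFinite _)
    intro x hx
    rw [Finset.mem_coe, Finset.mem_union, List.mem_toFinset, List.mem_toFinset] at hx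
    rcases hx with hx | hx
    · exact hsub c1 x hx
    · exact hsub c2 x hx
  · intro v1 v2 c1 c2 h1 h2 l1 l2 hne e he1 he2
    have h9 := two_cycles h h1 h2 hne
    have hsum := Finset.card_union_add_card_inter c1.support.toFinset c2.support.toFinset
    rw [cyc_card h1, cyc_card h2, l1, l2] at hsum
    have : 2 ≤ (c1.support.toFinset ∩ c2.support.toFinset).card := by
      induction e with | _ a b =>
      have hab : a ≠ b := (c1.adj_of_mem_edges he1).ne
      rw [← Finset.card_pair hab]
      apply Finset.card_le_card
      intro x hx
      rw [Finset.mem_insert, Finset.mem_singleton] at hx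
      rw [Finset.mem_inter, List.mem_toFinset, List.mem_toFinset]
      rcases hx with rfl | rfl
      · exact ⟨c1.fst_mem_support_of_mem_edges he1, c2.fst_mem_support_of_mem_edges he2⟩
      · exact ⟨c1.snd_mem_support_of_mem_edges he1, c2.snd_mem_support_of_mem_edges he2⟩
    omega
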